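/- Let w = (w_1, …, w_r) be a finite word in the letters {T, R} whose last letter is T, and for each j ≥ 0 let (X, v^{(j)}) be the state obtained by applying w_r ∘ ⋯ ∘ w_1 to the initial state (UP, e_0) in F^{j+1}. Define integers (p, s) by starting from (0, 1) and applying, for each letter of w in order, the map (x, y) ↦ (x+y, y) for T and (x, y) ↦ (x, x+y) for R. Assume that p is odd (so the closure is a rational knot) and that the final type X is UP or OP, and define P_j from v^{(j)} by the closure formulas: P_j := ∑_{k=0}^{j} v^{(j)}_k · a^{−j} q^{j²+k²} [j;k]_+ (a² q^{2−2j−2k}; q²)_j / (q²;q²)_j if X = UP, and P_j := ∑_{k=0}^{j} v^{(j)}_k · a^{k−j} q^{(j−k)²} [j;k]_+ (a² q^{2−2j}; q²)_{j−k} / (q²;q²)_{j−k} if X = OP. Then there exist an integer n ≥ 1, a symmetric matrix Q ∈ M_n(ℤ), and vectors 𝐪, 𝐚 ∈ ℤ^n such that for all j ≥ 0: P_j = ∑_{d ∈ ℕ^n, d_1+⋯+d_n = j} (−q)^{𝐪·d} a^{𝐚·d} q^{dᵀQd} [j; d_1, …, d_n]. (This is the strengthened quiver form for rational knots: the generating function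 of the reduced colored HOMFLY-PT polynomials divided by (q²;q²)_j is a specialization of a quiver generating function, equivalently ∑_j P_j x^j is in polynomial quiver form.) -/

import Mathlib

noncomputable section

open Finset

/-- The field `ℚ(q, a)` of rational functions in two variables. -/
abbrev F : Type := FractionRing (MvPolynomial (Fin 2) ℚ)

/-- The variable `q`. -/
def q : F := algebraMap (MvPolynomial (Fin 2) ℚ) F (MvPolynomial.X 0)

/-- The variable `a`. -/
def a : F := algebraMap (MvPolynomial (Fin 2) ℚ) F (MvPolynomial.X 1)

/-- The q-Pochhammer symbol `(x; y)_n = ∏_{j=0}^{n-1} (1 - x yʲ)`. -/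
def qPoch (x y : F) (n : ℕ) : F := ∏ i ∈ Finset.range n, (1 - x * y ^ i)

/-- `(q²;q²)_m = ∏_{i=1}^{m} (1 - q^{2i})`. -/
def qp (m : ℕ) : F := qPoch (q ^ 2) (q ^ 2) m

/-- The positive quantum binomial coefficient `[N; k]₊`. -/
def qbin (N k : ℕ) : F := qp N / (qp k * qp (N - k))

/-- Boundary orientation types of a 4-ended tangle. -/
inductive TangleType | UP | OP | RI
  deriving DecidableEq

/-- The two elementary twist operations: top twist `T` and right twist `R`. -/
inductive Letter | T | R
  deriving DecidableEq

/-- The boundary orientation type after applying one twist. -/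
def typeStep : Letter → TangleType → TangleType
  | Letter.T, TangleType.UP => TangleType.UP
  | Letter.T, TangleType.OP => TangleType.RI
  | Letter.T, TangleType.RI => TangleType.OP
  | Letter.R, TangleType.UP => TangleType.OP
  | Letter.R, TangleType.OP => TangleType.UP
  | Letter.R, TangleType.RI => TangleType.RI

/-- The boundary orientation type after applying a word of twists. -/
def typeWord : List Letter → TangleType → TangleType
  | [], X => X
  | l :: w, X => typeWord w (typeStep l X)

/-- The coefficient of the basis web `e_h` in the twist `l` applied to `(X, e_k)`,
for the `j`-colored HOMFLY-PT skein twist rules. -/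
def coef (l : Letter) (X : TangleType) (j k h : ℕ) : F :=
  match l, X with
  | Letter.T, TangleType.UP =>
      if k ≤ h ∧ h ≤ j then
        (-q) ^ ((h : ℤ) - (j : ℤ)) * q ^ ((k : ℤ) ^ 2) * qbin h k
      else 0
  | Letter.T, TangleType.OP =>
      if k ≤ h ∧ h ≤ j then
        (-q) ^ (h : ℤ) * a ^ (k : ℤ) *
          q ^ ((k : ℤ) ^ 2 - 2 * (j : ℤ) * (k : ℤ)) * qbin h k
      else 0
  | Letter.T, TangleType.RI =>
      if k ≤ h ∧ h ≤ j then
        (-q) ^ (h : ℤ) * a ^ (h : ℤ) *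
          q ^ ((k : ℤ) ^ 2 - 2 * (j : ℤ) * (h : ℤ)) * qbin h k
      else 0
  | Letter.R, TangleType.UP =>
      if h ≤ k then
        (-q) ^ ((h : ℤ) - (j : ℤ)) * a ^ ((h : ℤ) - (j : ℤ)) *
          q ^ (-2 * (k : ℤ) * (h : ℤ) + (k : ℤ) ^ 2 + (j : ℤ) ^ 2) * qbin (j - h) (k - h)
      else 0
  | Letter.R, TangleType.OP =>
      if h ≤ k then
        (-q) ^ ((h : ℤ) - (j : ℤ)) * a ^ ((k : ℤ) - (j : ℤ)) *
          q ^ (2 * (h : ℤ) * ((j : ℤ) - (k : ℤ)) + ((k : ℤ) - (j : ℤ)) ^ 2) *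
          qbin (j - h) (k - h)
      else 0
  | Letter.R, TangleType.RI =>
      if h ≤ k then
        (-q) ^ (h : ℤ) *
          q ^ ((h : ℤ) * (2 * (j : ℤ) - 2 * (k : ℤ)) + (k : ℤ) ^ 2 - (j : ℤ) ^ 2) *
          qbin (j - h) (k - h)
      else 0

/-- One twist applied (F-linearly) to the vector part of a state in `F^{j+1}`. -/
def stepVec (l : Letter) (X : TangleType) (j : ℕ) (v : Fin (j + 1) → F) :
    Fin (j + 1) → F :=
  fun h => ∑ k : Fin (j + 1), v k * coef l X j (k : ℕ) (h : ℕ)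

/-- The vector part of the state obtained by applying a word of twists to `(X, v)`. -/
def runVec : List Letter → TangleType → (j : ℕ) → (Fin (j + 1) → F) → (Fin (j + 1) → F)
  | [], _, _, v => v
  | l :: w, X, j, v => runVec w (typeStep l X) j (stepVec l X j v)

/-- The initial vector `e_0` (the trivial tangle). -/
def e0 (j : ℕ) : Fin (j + 1) → F := fun k => if (k : ℕ) = 0 then 1 else 0

/-- The reduced numerator closure applied to a state of type `UP`. -/
def closeUP (j : ℕ) (v : Fin (j + 1) → F) : F :=
  ∑ k : Fin (j + 1), v k *
    (a ^ (-(j : ℤ)) * q ^ ((j : ℤ) ^ 2 + ((k : ℕ) : ℤ) ^ 2) * qbin j (k : ℕ) *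
      (qPoch (a ^ 2 * q ^ (2 - 2 * (j : ℤ) - 2 * ((k : ℕ) : ℤ))) (q ^ 2) j / qp j))

/-- The reduced numerator (north–south) closure applied to a state of type `OP`. -/
def closeOP (j : ℕ) (v : Fin (j + 1) → F) : F :=
  ∑ k : Fin (j + 1), v k *
    (a ^ (((k : ℕ) : ℤ) - (j : ℤ)) * q ^ (((j : ℤ) - ((k : ℕ) : ℤ)) ^ 2) * qbin j (k : ℕ) *
      (qPoch (a ^ 2 * q ^ (2 - 2 * (j : ℤ))) (q ^ 2) (j - (k : ℕ)) / qp (j - (k : ℕ))))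

/-- One step of the continued-fraction recursion: `T : (x,y) ↦ (x+y,y)`,
`R : (x,y) ↦ (x,x+y)`. -/
def fracStep (l : Letter) (p : ℤ × ℤ) : ℤ × ℤ :=
  match l with
  | Letter.T => (p.1 + p.2, p.2)
  | Letter.R => (p.1, p.1 + p.2)

/-- The fraction `(p, s)` of the rational tangle built by the word `w`,
starting from `(0, 1)`. -/
def fracWord (w : List Letter) : ℤ × ℤ := w.foldl (fun p l => fracStep l p) (0, 1)

theorem q_ne_zero : q ≠ 0 := by
  rw [q, Ne, FaithfulSMul.algebraMap_eq_zero_iff]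
  exact MvPolynomial.X_ne_zero 0

theorem a_ne_zero : a ≠ 0 := by
  rw [a, Ne, FaithfulSMul.algebraMap_eq_zero_iff]
  exact MvPolynomial.X_ne_zero 1

theorem q_pow_ne_one {n : ℕ} (hn : n ≠ 0) : q ^ n ≠ 1 := by
  intro h
  rw [q, ← map_pow, ← map_one (algebraMap (MvPolynomial (Fin 2) ℚ) F)] at h
  have h' := congrArg (MvPolynomial.eval fun _ => (2 : ℚ))
    (FaithfulSMul.algebraMap_injective (MvPolynomial (Fin 2) ℚ) F h)
  simp only [map_pow, MvPolynomial.eval_X, map_one] at h'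
  exact (one_lt_pow₀ (by norm_num) hn).ne' h'

theorem qPoch_zero (x y : F) : qPoch x y 0 = 1 := by simp [qPoch]

theorem qPoch_succ (x y : F) (n : ℕ) :
    qPoch x y (n + 1) = qPoch x y n * (1 - x * y ^ n) := by
  simp [qPoch, prod_range_succ]

theorem qPoch_succ' (x y : F) (n : ℕ) :
    qPoch x y (n + 1) = (1 - x) * qPoch (x * y) y n := by
  simp only [qPoch, prod_range_succ', pow_zero, mul_one]
  rw [mul_comm]
  simp only [pow_succ', mul_assoc]

theorem qPoch_add (x y : F) (m n : ℕ) :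
    qPoch x y (m + n) = qPoch x y m * qPoch (x * y ^ m) y n := by
  simp only [qPoch, prod_range_add, pow_add, mul_assoc]

theorem qp_zero : qp 0 = 1 := qPoch_zero _ _

theorem qp_succ (n : ℕ) : qp (n + 1) = qp n * (1 - q ^ (2 * (n + 1))) := by
  rw [qp, qPoch_succ, ← qp]
  ring

theorem qp_add (m n : ℕ) : qp (m + n) = qp m * qPoch (q ^ (2 + 2 * m)) (q ^ 2) n := by
  rw [qp, qPoch_add, ← qp]
  congr 2
  ring

theorem qp_ne_zero (n : ℕ) : qp n ≠ 0 := by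
  induction n with
  | zero => simp [qp_zero]
  | succ n ih =>
    rw [qp_succ]
    exact mul_ne_zero ih (sub_ne_zero.2 (q_pow_ne_one (by omega)).symm)

/-- The quantum binomial coefficient `[x + y; x]₊` in symmetric form. -/
def qm (x y : ℕ) : F := qp (x + y) / (qp x * qp y)

theorem qbin_add (x y : ℕ) : qbin (x + y) x = qm x y := by simp [qbin, qm]

theorem qm_comm (x y : ℕ) : qm x y = qm y x := by
  rw [qm, qm, add_comm, mul_comm (qp x)]

theorem qm_zero_left (y : ℕ) : qm 0 y = 1 := by
  simp [qm, qp_zero, qp_ne_zero]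

/-- The `q`-Pascal rule, applied under a sum against an arbitrary function. -/
theorem sum_qm_succ (n : ℕ) (f : ℕ → ℕ → F) :
    ∑ p ∈ antidiagonal (n + 1), qm p.1 p.2 * f p.1 p.2 =
      ∑ p ∈ antidiagonal n,
        qm p.1 p.2 * (q ^ (2 * p.2) * f (p.1 + 1) p.2 + f p.1 (p.2 + 1)) := by
  have key : ∀ p ∈ antidiagonal (n + 1), qm p.1 p.2 * f p.1 p.2 =
      qp n * (1 - q ^ (2 * p.1)) / (qp p.1 * qp p.2) * q ^ (2 * p.2) * f p.1 p.2 +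
      qp n * (1 - q ^ (2 * p.2)) / (qp p.1 * qp p.2) * f p.1 p.2 := by
    rintro ⟨x, y⟩ h
    rw [HasAntidiagonal.mem_antidiagonal] at h
    simp only at h ⊢
    rw [qm, h, qp_succ, ← h]
    ring
  rw [sum_congr rfl key, sum_add_distrib, Finset.Nat.sum_antidiagonal_succ,
    Finset.Nat.sum_antidiagonal_succ' (n := n)]
  simp only [mul_zero, pow_zero, sub_self, zero_div, zero_mul, zero_add]
  rw [← sum_add_distrib]
  refine sum_congr rfl ?_
  rintro ⟨x, y⟩ h
  rw [HasAntidiagonal.mem_antidiagonal] at h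
  simp only at h ⊢
  have h1 : (1 : F) - q ^ (2 * (x + 1)) ≠ 0 := sub_ne_zero.2 (q_pow_ne_one (by omega)).symm
  have h2 : (1 : F) - q ^ (2 * (y + 1)) ≠ 0 := sub_ne_zero.2 (q_pow_ne_one (by omega)).symm
  have h3 := qp_ne_zero x
  have h4 := qp_ne_zero y
  rw [qm, h, qp_succ, qp_succ]
  field_simp

theorem sum_qm_swap (n : ℕ) (f : ℕ → ℕ → F) :
    ∑ p ∈ antidiagonal n, qm p.1 p.2 * f p.1 p.2 =
      ∑ p ∈ antidiagonal n, qm p.1 p.2 * f p.2 p.1 := by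
  rw [← Finset.Nat.sum_antidiagonal_swap]
  simp [qm_comm]

theorem sum_qm_succ' (n : ℕ) (f : ℕ → ℕ → F) :
    ∑ p ∈ antidiagonal (n + 1), qm p.1 p.2 * f p.1 p.2 =
      ∑ p ∈ antidiagonal n,
        qm p.1 p.2 * (f (p.1 + 1) p.2 + q ^ (2 * p.1) * f p.1 (p.2 + 1)) := by
  rw [sum_qm_swap, sum_qm_succ n fun x y => f y x,
    sum_qm_swap n fun x y => q ^ (2 * y) * f y (x + 1) + f (y + 1) x]
  exact sum_congr rfl fun p _ => by rw [add_comm (f _ _)]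

/-- The `q`-Vandermonde identity, applied under a sum against an arbitrary function. -/
theorem sum_qm_add (m n : ℕ) (f : ℕ → ℕ → F) :
    ∑ p ∈ antidiagonal (m + n), qm p.1 p.2 * f p.1 p.2 =
      ∑ p ∈ antidiagonal m, qm p.1 p.2 * ∑ r ∈ antidiagonal n, qm r.1 r.2 *
        (q ^ (2 * p.1 * r.2) * f (p.1 + r.1) (p.2 + r.2)) := by
  induction m generalizing f with
  | zero => simp [qm_zero_left]
  | succ m ih =>
    rw [show m + 1 + n = m + n + 1 by ring, sum_qm_succ,
      ih fun x y => q ^ (2 * y) * f (x + 1) y + f x (y + 1),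
      sum_qm_succ m fun x y => ∑ r ∈ antidiagonal n, qm r.1 r.2 *
        (q ^ (2 * x * r.2) * f (x + r.1) (y + r.2))]
    refine sum_congr rfl fun p _ => ?_
    congr 1
    rw [mul_sum, ← sum_add_distrib]
    refine sum_congr rfl fun r _ => ?_
    rw [show p.1 + 1 + r.1 = p.1 + r.1 + 1 by ring, show p.2 + 1 + r.2 = p.2 + r.2 + 1 by ring]
    ring

/-- The quantity `(-1)^i q^{i² - i}` of the `q`-binomial theorem. -/
def tri (i : ℕ) : F := (-1) ^ i * q ^ (i * (i - 1))

theorem tri_zero : tri 0 = 1 := by simp [tri]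

theorem tri_succ (i : ℕ) : tri (i + 1) = -(q ^ (2 * i) * tri i) := by
  rw [tri, tri]
  cases i with
  | zero => simp
  | succ i =>
    simp only [Nat.add_sub_cancel]
    ring

theorem tri_eq (i : ℕ) : tri i = (-q) ^ (-(i : ℤ)) * q ^ ((i : ℤ) ^ 2) := by
  induction i with
  | zero => simp [tri_zero]
  | succ i ih =>
    have hq := q_ne_zero
    rw [tri_succ, ih, show (-((i + 1 : ℕ) : ℤ)) = -(i : ℤ) + -1 by push_cast; ring,
      show ((i + 1 : ℕ) : ℤ) ^ 2 = (i : ℤ) ^ 2 + ((2 * i : ℕ) : ℤ) + 1 by push_cast; ring,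
      zpow_add₀ (neg_ne_zero.2 hq), zpow_add₀ hq, zpow_add₀ hq, zpow_natCast, zpow_one, zpow_neg_one]
    field_simp

/-- The `q`-binomial theorem. -/
theorem qPoch_eq_sum (x : F) (n : ℕ) :
    qPoch x (q ^ 2) n = ∑ p ∈ antidiagonal n, qm p.1 p.2 * (tri p.1 * x ^ p.1) := by
  induction n generalizing x with
  | zero => simp [qPoch_zero, tri_zero, qm_zero_left]
  | succ n ih =>
    rw [qPoch_succ', ih, sum_qm_succ' n fun i _ => tri i * x ^ i, mul_sum]
    refine sum_congr rfl fun p _ => ?_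
    rw [tri_succ]
    ring

/-- The `q`-Chu–Vandermonde summation. -/
theorem sum_qm_qPoch_mul_qPoch (n : ℕ) (t b : F) :
    ∑ p ∈ antidiagonal n, qm p.1 p.2 *
      (tri p.1 * t ^ p.1 * qPoch b (q ^ 2) p.1 * qPoch (t * b * q ^ (2 * p.1)) (q ^ 2) p.2) =
      qPoch t (q ^ 2) n := by
  induction n generalizing t with
  | zero => simp [qPoch_zero, tri_zero, qm_zero_left]
  | succ n ih =>
    rw [sum_qm_succ' n fun i m => tri i * t ^ i * qPoch b (q ^ 2) i *
      qPoch (t * b * q ^ (2 * i)) (q ^ 2) m, qPoch_succ', ← ih, mul_sum]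
    refine sum_congr rfl fun p _ => ?_
    rw [tri_succ, qPoch_succ, qPoch_succ' (t * b * _),
      show t * q ^ 2 * b * q ^ (2 * p.1) = t * b * q ^ (2 * p.1) * q ^ 2 by ring,
      show t * b * q ^ (2 * (p.1 + 1)) = t * b * q ^ (2 * p.1) * q ^ 2 by ring]
    ring

/-- Iterated `q`-differences of a `q`-Pochhammer symbol. -/
theorem sum_qm_qPoch_shift (n k : ℕ) (x : F) :
    qp k * ∑ p ∈ antidiagonal n, qm p.1 p.2 *
      (tri p.1 * q ^ ((2 + 2 * k) * p.1) *
        qPoch (x * ((q ^ 2) ^ p.1)⁻¹) (q ^ 2) (n + k)) =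
      qp (n + k) * qPoch x (q ^ 2) k := by
  induction n with
  | zero => simp [qm_zero_left, tri_zero]
  | succ n ih =>
    have hq := q_ne_zero
    rw [show n + 1 + k = n + k + 1 by ring, qp_succ, mul_right_comm, ← ih,
      sum_qm_succ n fun i _ => tri i * q ^ ((2 + 2 * k) * i) *
        qPoch (x * ((q ^ 2) ^ i)⁻¹) (q ^ 2) (n + k + 1), mul_assoc, sum_mul]
    congr 1
    refine sum_congr rfl fun p hp => ?_
    rw [HasAntidiagonal.mem_antidiagonal] at hp
    rw [tri_succ, qPoch_succ (x * ((q ^ 2) ^ p.1)⁻¹), qPoch_succ', ← hp,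
      show x * ((q ^ 2) ^ (p.1 + 1))⁻¹ * q ^ 2 = x * ((q ^ 2) ^ p.1)⁻¹ by
        rw [pow_succ]; field_simp]
    generalize qPoch _ _ _ = P
    field_simp
    ring

section Mono

variable {M N : Type*} [AddCommMonoid M] [AddCommMonoid N]

/-- Additive integer-valued functions. -/
def IsLin (f : M → ℤ) : Prop := ∀ x y, f (x + y) = f x + f y

/-- Symmetric biadditive integer-valued functions. -/
def IsBilin (b : M → M → ℤ) : Prop :=
  (∀ x y, b x y = b y x) ∧ ∀ x y z, b (x + y) z = b x z + b y z

/-- Weights of the form `(-q)^{linear} a^{linear} q^{quadratic}`. -/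
def IsMono (W : M → F) : Prop :=
  ∃ (l m : M → ℤ) (b : M → M → ℤ), IsLin l ∧ IsLin m ∧ IsBilin b ∧
    ∀ x, W x = (-q) ^ l x * a ^ m x * q ^ b x x

theorem IsMono.mul {V W : M → F} (hV : IsMono V) (hW : IsMono W) :
    IsMono fun x => V x * W x := by
  obtain ⟨l, m, b, hl, hm, hb, h⟩ := hV
  obtain ⟨l', m', b', hl', hm', hb', h'⟩ := hW
  refine ⟨fun x => l x + l' x, fun x => m x + m' x, fun x y => b x y + b' x y,
    fun x y => ?_, fun x y => ?_, ⟨fun x y => ?_, fun x y z => ?_⟩, fun x => ?_⟩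
  · beta_reduce; rw [hl, hl']; ring
  · beta_reduce; rw [hm, hm']; ring
  · beta_reduce; rw [hb.1, hb'.1]
  · beta_reduce; rw [hb.2, hb'.2]; ring
  · beta_reduce; rw [h, h', zpow_add₀ (neg_ne_zero.2 q_ne_zero), zpow_add₀ a_ne_zero, zpow_add₀ q_ne_zero]
    ring

theorem IsMono.comp {W : M → F} (hW : IsMono W) {f : N → M}
    (hf : ∀ x y, f (x + y) = f x + f y) : IsMono fun x => W (f x) := by
  obtain ⟨l, m, b, hl, hm, hb, h⟩ := hW
  exact ⟨fun x => l (f x), fun x => m (f x), fun x y => b (f x) (f y),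
    fun x y => by beta_reduce; rw [hf, hl], fun x y => by beta_reduce; rw [hf, hm],
    ⟨fun x y => hb.1 _ _, fun x y z => by beta_reduce; rw [hf, hb.2]⟩, fun x => h _⟩

theorem isMono_neg_q {l : M → ℤ} (hl : IsLin l) : IsMono fun x => (-q) ^ l x :=
  ⟨l, 0, 0, hl, fun _ _ => by simp, ⟨fun _ _ => rfl, fun _ _ _ => by simp⟩, fun x => by simp⟩

theorem isMono_q_sq {l : M → ℤ} (hl : IsLin l) : IsMono fun x => q ^ (l x ^ 2) :=
  ⟨0, 0, fun x y => l x * l y, fun _ _ => by simp, fun _ _ => by simp,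
    ⟨fun _ _ => mul_comm _ _, fun _ _ _ => by beta_reduce; rw [hl]; ring⟩, fun x => by simp [sq]⟩

theorem isMono_q_bilin {b : M → M → ℤ} (h₁ : ∀ x y z, b (x + y) z = b x z + b y z)
    (h₂ : ∀ x y z, b x (y + z) = b x y + b x z) : IsMono fun x => q ^ (2 * b x x) :=
  ⟨0, 0, fun x y => b x y + b y x, fun _ _ => by simp, fun _ _ => by simp,
    ⟨fun _ _ => add_comm _ _, fun _ _ _ => by beta_reduce; rw [h₁, h₂]; ring⟩, fun x => by simp [two_mul]⟩

theorem isMono_q_lin {l : M → ℤ} (hl : IsLin l) : IsMono fun x => q ^ (2 * l x) := by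
  have := isMono_neg_q (l := fun x => 2 * l x) (fun x y => by beta_reduce; rw [hl]; ring)
  simpa only [zpow_mul, neg_sq, zpow_ofNat] using this

end Mono

theorem isMono_tri {r : ℕ} (k : Fin r) : IsMono fun n : Fin r → ℕ => tri (n k) := by
  have h : IsLin fun n : Fin r → ℕ => ((n k : ℕ) : ℤ) := fun x y => by simp
  have h' : IsLin fun n : Fin r → ℕ => -((n k : ℕ) : ℤ) := fun x y => by simp; ring
  simpa only [tri_eq] using (isMono_neg_q h').mul (isMono_q_sq h)

theorem IsLin.eq_sum {ι : Type*} [Fintype ι] [DecidableEq ι] {l : (ι → ℕ) → ℤ} (hl : IsLin l)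
    (x : ι → ℕ) : l x = ∑ i, l (Pi.single i 1) * (x i : ℤ) := by
  have h0 : l 0 = 0 := by simpa using hl 0 0
  let g : (ι → ℕ) →+ ℤ := ⟨⟨l, h0⟩, hl⟩
  have hg : ∀ y, g y = l y := fun _ => rfl
  rw [← hg x]
  conv_lhs => rw [← Finset.univ_sum_single x, map_sum]
  refine sum_congr rfl fun i _ => ?_
  rw [show (Pi.single i (x i) : ι → ℕ) = x i • Pi.single i 1 by
    ext j; simp [Pi.single_apply], map_nsmul, hg, nsmul_eq_mul, mul_comm]

section Vandermonde

variable {ι : Type*} [Fintype ι] [DecidableEq ι]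

/-- The vectors supported on `s` and bounded by `d`. -/
def subBox (s : Finset ι) (d : ι → ℕ) : Finset (ι → ℕ) :=
  Fintype.piFinset fun i => range (if i ∈ s then d i + 1 else 1)

theorem mem_subBox {s : Finset ι} {d x : ι → ℕ} :
    x ∈ subBox s d ↔ ∀ i, x i ≤ d i ∧ (i ∉ s → x i = 0) := by
  simp only [subBox, Fintype.mem_piFinset, mem_range]
  refine forall_congr' fun i => ?_
  split_ifs with h
  · simp [h]
  · simp [h]
    omega

theorem sum_subBox_insert {s : Finset ι} {i₀ : ι} (hi : i₀ ∉ s) (d : ι → ℕ) (g : (ι → ℕ) → F) :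
    ∑ x ∈ subBox (insert i₀ s) d, g x =
      ∑ p ∈ antidiagonal (d i₀), ∑ x ∈ subBox s d, g (Function.update x i₀ p.1) := by
  rw [← sum_product']
  symm
  refine sum_nbij' (fun z => Function.update z.2 i₀ z.1.1)
    (fun x => ((x i₀, d i₀ - x i₀), Function.update x i₀ 0)) ?_ ?_ ?_ ?_ ?_
  · rintro ⟨⟨m, n⟩, x⟩ h
    simp only [mem_product, HasAntidiagonal.mem_antidiagonal, mem_subBox] at h ⊢
    intro i
    rcases eq_or_ne i i₀ with rfl | hne
    · simp; omega
    · simpa [hne] using h.2 i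
  · intro x h
    simp only [mem_product, HasAntidiagonal.mem_antidiagonal, mem_subBox] at h ⊢
    refine ⟨by have := h i₀; omega, fun i => ?_⟩
    rcases eq_or_ne i i₀ with rfl | hne
    · simp
    · simpa [hne] using h i
  · rintro ⟨⟨m, n⟩, x⟩ h
    simp only [mem_product, HasAntidiagonal.mem_antidiagonal, mem_subBox] at h
    have h0 := (h.2 i₀).2 hi
    have hx : Function.update x i₀ 0 = x := by rw [← h0, Function.update_eq_self]
    simp [hx]
    omega
  · intro x _
    simp
  · intro _ _
    rfl

/-- The `q`-Vandermonde identity for splitting a multi-index into two parts. -/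
theorem exists_sum_qm_sum (s : Finset ι) :
    ∃ ω : (ι → ℕ) → (ι → ℕ) → ℕ,
      (∀ x y z, ω (x + y) z = ω x z + ω y z) ∧ (∀ x y z, ω x (y + z) = ω x y + ω x z) ∧
      (∀ x x' y y', (∀ i ∈ s, x i = x' i) → (∀ i ∈ s, y i = y' i) → ω x y = ω x' y') ∧
      ∀ (d : ι → ℕ) (f : ℕ → ℕ → F),
        ∑ p ∈ antidiagonal (∑ i ∈ s, d i), qm p.1 p.2 * f p.1 p.2 =
          ∑ x ∈ subBox s d, (∏ i ∈ s, qm (x i) (d i - x i)) *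
            (q ^ (2 * ω x (d - x)) * f (∑ i ∈ s, x i) (∑ i ∈ s, (d i - x i))) := by
  induction s using Finset.induction_on with
  | empty =>
    refine ⟨fun _ _ => 0, by simp, by simp, by simp, fun d f => ?_⟩
    have : subBox ∅ d = {0} := by
      ext x
      simp only [mem_subBox, mem_singleton, funext_iff]
      exact forall_congr' fun i => by simp; omega
    simp [this, qm_zero_left]
  | insert i₀ s hi ih =>
    obtain ⟨ω, h₁, h₂, h₃, h₄⟩ := ih
    refine ⟨fun x y => x i₀ * ∑ i ∈ s, y i + ω x y, fun x y z => ?_, fun x y z => ?_,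
      fun x x' y y' hx hy => ?_, fun d f => ?_⟩
    · simp only [h₁, Pi.add_apply]; ring
    · simp only [h₂, Pi.add_apply, sum_add_distrib]; ring
    · have hx' := fun i hi => hx i (mem_insert_of_mem hi)
      have hy' := fun i hi => hy i (mem_insert_of_mem hi)
      beta_reduce
      rw [hx _ (mem_insert_self _ _), sum_congr rfl hy', h₃ _ _ _ _ hx' hy']
    · rw [sum_insert hi, sum_qm_add, sum_subBox_insert hi]
      refine sum_congr rfl fun p hp => ?_
      rw [HasAntidiagonal.mem_antidiagonal] at hp
      rw [h₄ d fun x y => q ^ (2 * p.1 * y) * f (p.1 + x) (p.2 + y), mul_sum]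
      refine sum_congr rfl fun x _ => ?_
      have hs : ∀ i ∈ s, Function.update x i₀ p.1 i = x i := fun i his =>
        Function.update_of_ne (fun h : i = i₀ => hi (h ▸ his)) _ _
      have hs' : ∀ i ∈ s, (d - Function.update x i₀ p.1) i = (d - x) i := fun i his => by
        simp [hs i his]
      have hs₁ : ∏ i ∈ s, qm (Function.update x i₀ p.1 i) (d i - Function.update x i₀ p.1 i) =
          ∏ i ∈ s, qm (x i) (d i - x i) := prod_congr rfl fun i h => by rw [hs i h]
      have hs₂ : ∑ i ∈ s, (d i - Function.update x i₀ p.1 i) = ∑ i ∈ s, (d i - x i) :=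
        sum_congr rfl fun i h => by rw [hs i h]
      beta_reduce
      rw [prod_insert hi, sum_insert hi, sum_insert hi, Function.update_self,
        h₃ _ _ _ _ hs hs', sum_congr rfl hs', sum_congr rfl hs, hs₁, hs₂,
        show d i₀ - p.1 = p.2 by omega]
      simp only [Pi.sub_apply]
      ring

end Vandermonde

section Quiver

set_option linter.unusedSectionVars false

variable {ι κ κ' : Type} [Fintype ι] [DecidableEq ι] [Fintype κ] [DecidableEq κ]
  [Fintype κ'] [DecidableEq κ']

/-- The colour content of a vector whose coordinates are coloured by `c`. -/
def push (c : ι → κ) (d : ι → ℕ) (k : κ) : ℕ := ∑ i with c i = k, d i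

/-- The vectors of prescribed colour content. -/
def fib (c : ι → κ) (n : κ → ℕ) : Finset (ι → ℕ) :=
  (Fintype.piFinset fun i => range (n (c i) + 1)).filter fun d => push c d = n

theorem mem_fib {c : ι → κ} {n : κ → ℕ} {d : ι → ℕ} : d ∈ fib c n ↔ push c d = n := by
  refine ⟨fun h => (mem_filter.1 h).2, fun h => mem_filter.2 ⟨?_, h⟩⟩
  rw [Fintype.mem_piFinset]
  intro i
  rw [mem_range, Nat.lt_succ_iff, ← h]
  exact single_le_sum (f := d) (fun _ _ => Nat.zero_le _) (by simp)

theorem push_add (c : ι → κ) (x y : ι → ℕ) : push c (x + y) = push c x + push c y := by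
  ext k
  simp [push, sum_add_distrib]

theorem push_push (c : ι → κ) (g : κ → κ') (d : ι → ℕ) :
    push g (push c d) = push (g ∘ c) d := by
  ext k
  simp only [push, Function.comp_apply]
  rw [← sum_fiberwise_of_maps_to (s := univ.filter fun i => g (c i) = k)
    (t := univ.filter fun l => g l = k) (g := c) (by simp)]
  refine sum_congr rfl fun l hl => sum_congr ?_ fun _ _ => rfl
  ext i
  simp only [mem_filter, mem_univ, true_and] at hl ⊢
  exact ⟨fun h => ⟨h ▸ hl, h⟩, fun h => h.2⟩

/-- The product of `(q²;q²)_{n_k}` over all colours. -/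
def qn (n : κ → ℕ) : F := ∏ k, qp (n k)

theorem qn_ne_zero (n : κ → ℕ) : qn n ≠ 0 := prod_ne_zero_iff.2 fun _ _ => qp_ne_zero _

/-- Coloured quiver form: sums of monomial weights against `q`-multinomial coefficients, one for
each colour. -/
def IsQ (U : (κ → ℕ) → F) : Prop :=
  ∃ (ι : Type) (_ : Fintype ι) (_ : DecidableEq ι) (_ : Nonempty ι) (c : ι → κ)
    (W : (ι → ℕ) → F), IsMono W ∧ ∀ n, U n = qn n * ∑ d ∈ fib c n, W d * (qn d)⁻¹

theorem IsMono.isQ [Nonempty κ] {W : (κ → ℕ) → F} (hW : IsMono W) : IsQ W := by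
  refine ⟨κ, inferInstance, inferInstance, inferInstance, id, W, hW, fun n => ?_⟩
  have hp : ∀ d : κ → ℕ, push id d = d := fun d => by ext; simp [push, sum_filter]
  have : fib id n = {n} := by ext d; rw [mem_fib, mem_singleton, hp]
  rw [this, sum_singleton, mul_comm (W n), mul_inv_cancel_left₀ (qn_ne_zero n)]

theorem IsQ.mul {U W : (κ → ℕ) → F} (hU : IsQ U) (hW : IsMono W) :
    IsQ fun n => W n * U n := by
  obtain ⟨ι, _, _, _, c, W', hW', h⟩ := hU
  refine ⟨ι, inferInstance, inferInstance, inferInstance, c, _, hW'.mul (hW.comp (push_add c)), fun n => ?_⟩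
  beta_reduce
  rw [h, mul_left_comm, mul_sum (fib c n) _ (W n)]
  congr 1
  refine sum_congr rfl fun d hd => ?_
  rw [mem_fib.1 hd]
  ring

theorem IsQ.pushforward {U : (κ → ℕ) → F} (hU : IsQ U) (g : κ → κ') :
    IsQ fun n' => qn n' * ∑ n ∈ fib g n', (qn n)⁻¹ * U n := by
  obtain ⟨ι, _, _, _, c, W, hW, h⟩ := hU
  refine ⟨ι, inferInstance, inferInstance, inferInstance, g ∘ c, W, hW, fun n' => ?_⟩
  have hmaps : ∀ d ∈ fib (g ∘ c) n', push c d ∈ fib g n' := fun d hd => by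
    rw [mem_fib] at hd ⊢
    rw [push_push, hd]
  rw [← sum_fiberwise_of_maps_to hmaps]
  refine congrArg (qn n' * ·) (sum_congr rfl fun n hn => ?_)
  rw [h, inv_mul_cancel_left₀ (qn_ne_zero n)]
  refine sum_congr ?_ fun _ _ => rfl
  ext d
  rw [mem_filter, mem_fib, mem_fib]
  refine ⟨fun hd => ⟨?_, hd⟩, fun hd => hd.2⟩
  rw [← push_push, hd, mem_fib.1 hn]

theorem IsQ.reindex {U : (κ → ℕ) → F} (hU : IsQ U) (e : κ ≃ κ') :
    IsQ fun n : κ' → ℕ => U (n ∘ e) := by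
  convert hU.pushforward e with n
  have hp : ∀ d : κ → ℕ, push e d = d ∘ e.symm := fun d => by
    ext k
    simp only [push, sum_filter, ← Equiv.eq_symm_apply, Function.comp_apply]
    simp
  have : fib e n = {n ∘ e} := by
    ext d
    rw [mem_fib, mem_singleton, hp, Equiv.comp_symm_eq]
  have hq : qn (n ∘ e) = qn n := Equiv.prod_comp e fun k => qp (n k)
  rw [this, sum_singleton, hq, mul_inv_cancel_left₀ (qn_ne_zero n)]

theorem push_cons {r : ℕ} (k₀ : Fin r) (d : Fin (r + 1) → ℕ) (k : Fin r) :
    push (Fin.cons k₀ id : Fin (r + 1) → Fin r) d k =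
      (if k = k₀ then d 0 else 0) + d k.succ := by
  simp [push, sum_filter, Fin.sum_univ_succ, eq_comm]

theorem qn_cons {r : ℕ} (x : ℕ) (n : Fin r → ℕ) :
    qn (Fin.cons x n : Fin (r + 1) → ℕ) = qp x * qn n := by
  simp [qn, Fin.prod_univ_succ]

theorem qn_update (n : κ → ℕ) (k : κ) (y : ℕ) :
    qp (n k) * qn (Function.update n k y) = qp y * qn n := by
  rw [qn, qn, ← mul_prod_erase univ _ (mem_univ k),
    ← mul_prod_erase univ (fun k => qp (n k)) (mem_univ k), Function.update_self,
    prod_congr rfl fun l hl => by rw [Function.update_of_ne (ne_of_mem_erase hl)]]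
  ring

/-- Colour `0` is merged into colour `k₀`. -/
theorem IsQ.merge {r : ℕ} {V : (Fin (r + 1) → ℕ) → F} (hV : IsQ V) (k₀ : Fin r) :
    IsQ fun n : Fin r → ℕ => ∑ p ∈ antidiagonal (n k₀),
      qm p.1 p.2 * V (Fin.cons p.1 (Function.update n k₀ p.2)) := by
  convert hV.pushforward (Fin.cons k₀ id) with n
  rw [mul_sum]
  refine sum_nbij' (fun p => Fin.cons p.1 (Function.update n k₀ p.2))
    (fun d => (d 0, d k₀.succ)) (fun p hp => ?_) (fun d hd => ?_) (fun p _ => by simp)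
    (fun d hd => ?_) fun p hp => ?_
  · rw [HasAntidiagonal.mem_antidiagonal] at hp
    rw [mem_fib]
    ext k
    rw [push_cons]
    rcases eq_or_ne k k₀ with rfl | hk
    · simpa using hp
    · simp [hk]
  · rw [mem_fib] at hd
    rw [HasAntidiagonal.mem_antidiagonal, ← hd, push_cons]
    simp
  · rw [mem_fib] at hd
    ext k
    refine Fin.cases rfl (fun k => ?_) k
    rcases eq_or_ne k k₀ with rfl | hk
    · simp
    · rw [Fin.cons_succ, Function.update_of_ne hk, ← hd, push_cons]
      simp [hk]
  · rw [HasAntidiagonal.mem_antidiagonal] at hp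
    have h := qn_update n k₀ p.2
    rw [qn_cons, ← mul_assoc, qm, hp]
    congr 1
    have := qp_ne_zero p.1
    have := qp_ne_zero p.2
    have := qn_ne_zero (Function.update n k₀ p.2)
    field_simp
    linear_combination h

end Quiver

section Split

variable {r : ℕ} (k₀ : Fin r)

/-- The map on colours merging colour `0` into colour `k₀`. -/
def mergeColour (m : Fin (r + 1) → ℕ) (k : Fin r) : ℕ := m k.succ + if k = k₀ then m 0 else 0

theorem qn_mergeColour (m : Fin (r + 1) → ℕ) :
    qn (mergeColour k₀ m) = qn m * qm (m 0) (m k₀.succ) := by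
  have h : mergeColour k₀ m =
      Function.update (fun k : Fin r => m k.succ) k₀ (m 0 + m k₀.succ) := by
    ext k
    rcases eq_or_ne k k₀ with rfl | hk
    · simp [mergeColour, add_comm]
    · simp [mergeColour, hk]
  have h₁ := qn_update (fun k : Fin r => m k.succ) k₀ (m 0 + m k₀.succ)
  have h₂ : qn m = qp (m 0) * qn fun k : Fin r => m k.succ := by simp [qn, Fin.prod_univ_succ]
  have := qp_ne_zero (m 0)
  have := qp_ne_zero (m k₀.succ)
  rw [h, h₂, qm]
  field_simp
  linear_combination h₁

/-- Colour `k₀` is split into two colours. -/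
theorem IsQ.split {U : (Fin r → ℕ) → F} (hU : IsQ U) :
    IsQ fun m : Fin (r + 1) → ℕ => U (mergeColour k₀ m) := by
  obtain ⟨ι, _, _, _, c, W, hW, h⟩ := hU
  let s : Finset ι := univ.filter fun i => c i = k₀
  obtain ⟨ω, ω₁, ω₂, ω₃, ω₄⟩ := exists_sum_qm_sum s
  let X : (ι ⊕ s → ℕ) → ι → ℕ := fun d i => if hi : i ∈ s then d (Sum.inr ⟨i, hi⟩) else 0
  let Y : (ι ⊕ s → ℕ) → ι → ℕ := fun d i => d (Sum.inl i)
  have hX : ∀ d d', X (d + d') = X d + X d' := fun d d' => by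
    ext i; by_cases hi : i ∈ s <;> simp [X, hi]
  have hY : ∀ d d', Y (d + d') = Y d + Y d' := fun _ _ => rfl
  have hXs : ∀ d (i : s), X d i = d (Sum.inr i) := fun d i => by simp [X]
  have hXn : ∀ d, ∀ i ∉ s, X d i = 0 := fun d i hi => by simp [X, hi]
  let c' : ι ⊕ s → Fin (r + 1) := Sum.elim (fun i => (c i).succ) fun _ => 0
  have hc₀ : ∀ d, push c' d 0 = ∑ i ∈ s, X d i := fun d => by
    rw [push, sum_filter, Fintype.sum_sum_type, ← sum_coe_sort s]
    simp [c', hXs]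
  have hc₁ : ∀ d k, push c' d k.succ = push c (Y d) k := fun d k => by
    simp [push, sum_filter, Fintype.sum_sum_type, c', Y, Fin.succ_ne_zero, eq_comm]
  have hqn : ∀ d, (qn d)⁻¹ =
      (qn (X d + Y d))⁻¹ * ∏ i ∈ s, qm (X d i) ((X d + Y d) i - X d i) := fun d => by
    have e₁ : qn d = (∏ i, qp (Y d i)) * ∏ i ∈ s, qp (X d i) := by
      rw [qn, Fintype.prod_sum_type, ← prod_coe_sort s]
      simp [hXs, Y]
    rw [e₁, qn, ← prod_mul_prod_compl s fun i => qp (Y d i),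
      ← prod_mul_prod_compl s fun i => qp ((X d + Y d) i)]
    have e₂ : ∏ i ∈ sᶜ, qp ((X d + Y d) i) = ∏ i ∈ sᶜ, qp (Y d i) :=
      prod_congr rfl fun i hi => by rw [Pi.add_apply, hXn d i (mem_compl.1 hi), zero_add]
    have e₃ : ∏ i ∈ s, qm (X d i) ((X d + Y d) i - X d i) =
        (∏ i ∈ s, qp ((X d + Y d) i)) / ((∏ i ∈ s, qp (X d i)) * ∏ i ∈ s, qp (Y d i)) := by
      simp only [Pi.add_apply, Nat.add_sub_cancel_left, qm, prod_div_distrib, prod_mul_distrib]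
    have n₁ : ∏ i ∈ s, qp ((X d + Y d) i) ≠ 0 := prod_ne_zero_iff.2 fun _ _ => qp_ne_zero _
    have n₂ : ∏ i ∈ s, qp (X d i) ≠ 0 := prod_ne_zero_iff.2 fun _ _ => qp_ne_zero _
    have n₃ : ∏ i ∈ s, qp (Y d i) ≠ 0 := prod_ne_zero_iff.2 fun _ _ => qp_ne_zero _
    have n₄ : ∏ i ∈ sᶜ, qp (Y d i) ≠ 0 := prod_ne_zero_iff.2 fun _ _ => qp_ne_zero _
    rw [e₂, e₃]
    field_simp
  refine ⟨ι ⊕ s, inferInstance, inferInstance, inferInstance, c',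
    fun d => W (X d + Y d) * q ^ (2 * (ω (X d) (Y d) : ℤ)), ?_, fun m => ?_⟩
  · refine (hW.comp fun d d' => ?_).mul (isMono_q_bilin (b := fun d d' => (ω (X d) (Y d') : ℤ))
      (fun d d' z => ?_) fun d d' z => ?_)
    · rw [hX, hY]; abel
    · rw [hX, ω₁]; push_cast; rfl
    · rw [hY, ω₂]; push_cast; rfl
  have hm := qn_mergeColour k₀ m
  have hXe : ∀ x y : ι → ℕ, (∀ i ∉ s, x i = 0) → X (Sum.elim y fun i => x i) = x :=
    fun x y hx => by
      ext i
      by_cases hi : i ∈ s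
      · simp [X, hi]
      · simp [X, hi, hx i hi]
  have key : ∀ d ∈ fib c (mergeColour k₀ m), qm (m 0) (m k₀.succ) =
      ∑ x ∈ (subBox s d).filter (fun x => ∑ i ∈ s, x i = m 0),
        (∏ i ∈ s, qm (x i) (d i - x i)) * q ^ (2 * ω x (d - x)) := fun d hd => by
    have hd' : ∑ i ∈ s, d i = m 0 + m k₀.succ := by
      have := congrFun (mem_fib.1 hd) k₀
      simpa [push, mergeColour, add_comm] using this
    have := ω₄ d fun x _ => if x = m 0 then 1 else 0
    simp only [mul_ite, mul_one, mul_zero] at this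
    rw [← sum_filter, ← sum_filter, hd'] at this
    rw [← this, sum_eq_single_of_mem (m 0, m k₀.succ) (by simp)]
    rintro ⟨x, y⟩ hp hne
    simp only [mem_filter, HasAntidiagonal.mem_antidiagonal] at hp
    exact absurd (Prod.ext hp.2 (by simp; omega)) hne
  beta_reduce
  rw [h, hm, mul_assoc]
  refine congrArg (qn m * ·) ?_
  rw [mul_sum, sum_congr rfl fun d hd => by rw [key d hd, sum_mul], sum_sigma']
  symm
  refine sum_bij' (fun d _ => ⟨X d + Y d, X d⟩)
    (fun p _ => Sum.elim (p.1 - p.2) fun i => p.2 i) ?_ ?_ ?_ ?_ ?_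
  · intro d hd
    rw [mem_fib] at hd
    simp only [mem_sigma, mem_filter, mem_fib, mem_subBox]
    refine ⟨?_, fun i => ⟨by simp, hXn d i⟩, by rw [← hc₀, hd]⟩
    ext k
    rw [push_add, Pi.add_apply, ← hc₁, hd, mergeColour, add_comm]
    congr 1
    split_ifs with hk
    · rw [← hd, hc₀, hk]
      rfl
    · exact sum_eq_zero fun i hi => hXn d i fun hs => hk (by
        rw [← (mem_filter.1 hi).2, (mem_filter.1 hs).2])
  · rintro ⟨d, x⟩ hp
    simp only [mem_sigma, mem_filter, mem_fib, mem_subBox] at hp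
    obtain ⟨hd, hx, hm₀⟩ := hp
    have hxs : X (Sum.elim (d - x) fun i => x i) = x := hXe _ _ fun i => (hx i).2
    have hdx : d - x + x = d := funext fun i => Nat.sub_add_cancel (hx i).1
    rw [mem_fib]
    ext k
    refine Fin.cases ?_ (fun k => ?_) k
    · rw [hc₀, hxs, hm₀]
    · rw [hc₁]
      have h₁ := congrFun hd k
      rw [← hdx, push_add, Pi.add_apply, mergeColour] at h₁
      have h₂ : push c x k = if k = k₀ then m 0 else 0 := by
        split_ifs with hk
        · rw [← hm₀, hk]
          rfl
        · exact sum_eq_zero fun i hi => (hx i).2 fun hs => hk (by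
            rw [← (mem_filter.1 hi).2, (mem_filter.1 hs).2])
      rw [h₂] at h₁
      exact Nat.add_right_cancel h₁
  · intro d hd
    ext i
    rcases i with i | i
    · simp [Y]
    · simp [hXs]
  · rintro ⟨d, x⟩ hp
    simp only [mem_sigma, mem_filter, mem_fib, mem_subBox] at hp
    obtain ⟨hd, hx, hm₀⟩ := hp
    have hxs : X (Sum.elim (d - x) fun i => x i) = x := hXe _ _ fun i => (hx i).2
    have hdx : x + (d - x) = d := funext fun i => Nat.add_sub_cancel' (hx i).1
    have hy : Y (Sum.elim (d - x) fun i => x i) = d - x := rfl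
    simp only [hxs, hy, hdx]
  · intro d hd
    rw [hqn]
    simp only [add_tsub_cancel_left]
    norm_cast
    ring

end Split

/-- The monomial `(-q)^x a^y q^z`. -/
def mon (x y z : ℤ) : F := (-q) ^ x * a ^ y * q ^ z

theorem mon_mul (x y z x' y' z' : ℤ) : mon x y z * mon x' y' z' = mon (x + x') (y + y') (z + z') := by
  rw [mon, mon, mon, zpow_add₀ (neg_ne_zero.2 q_ne_zero), zpow_add₀ a_ne_zero, zpow_add₀ q_ne_zero]
  ring

theorem mon_pow (x y z : ℤ) (n : ℕ) : mon x y z ^ n = mon (x * n) (y * n) (z * n) := by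
  simp only [mon, mul_pow, zpow_mul, zpow_natCast]

theorem tri_eq_mon (i : ℕ) : tri i = mon (-i) 0 ((i : ℤ) ^ 2) := by rw [tri_eq, mon]; simp

theorem q_pow_eq_mon (n : ℕ) : q ^ n = mon 0 0 n := by simp [mon]

theorem isMono_mon {r : ℕ} (l m L : (Fin r → ℕ) → ℤ) (b : (Fin r → ℕ) → (Fin r → ℕ) → ℤ)
    (hl : IsLin l := by intro x y; (try simp only [Pi.add_apply, Nat.cast_add]) <;> ring1)
    (hm : IsLin m := by intro x y; (try simp only [Pi.add_apply, Nat.cast_add]) <;> ring1)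
    (hL : IsLin L := by intro x y; (try simp only [Pi.add_apply, Nat.cast_add]) <;> ring1)
    (hb : ∀ x y, b x y = b y x := by intro x y; ring)
    (hb' : ∀ x y z, b (x + y) z = b x z + b y z := by
      intro x y z; (try simp only [Pi.add_apply, Nat.cast_add]) <;> ring1) :
    IsMono fun x => mon (l x) (m x) (b x x + 2 * L x) := by
  convert (show IsMono (fun x => (-q) ^ l x * a ^ m x * q ^ b x x) from
    ⟨l, m, b, hl, hm, ⟨hb, hb'⟩, fun _ => rfl⟩).mul (isMono_q_lin hL) using 2 with x
  rw [mon, zpow_add₀ q_ne_zero]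
  ring

theorem mergeColour_cons {r : ℕ} (k₀ : Fin r) (n : Fin r → ℕ) {p : ℕ × ℕ}
    (hp : p ∈ antidiagonal (n k₀)) :
    mergeColour k₀ (Fin.cons p.1 (Function.update n k₀ p.2)) = n := by
  rw [HasAntidiagonal.mem_antidiagonal] at hp
  ext k
  rcases eq_or_ne k k₀ with rfl | hk
  · simp [mergeColour, ← hp, add_comm]
  · simp [mergeColour, hk]

theorem mergeColour_add {r : ℕ} (k₀ : Fin r) (m m' : Fin (r + 1) → ℕ) :
    mergeColour k₀ (m + m') = mergeColour k₀ m + mergeColour k₀ m' := by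
  ext k
  simp only [mergeColour, Pi.add_apply]
  split_ifs <;> ring

theorem IsQ.mul_qPoch {r : ℕ} {U : (Fin r → ℕ) → F} (hU : IsQ U) (k₀ : Fin r) (s t : ℤ)
    (L : (Fin r → ℕ) → ℤ)
    (hL : IsLin L := by intro x y; (try simp only [Pi.add_apply, Nat.cast_add]) <;> ring1) :
    IsQ fun n => qPoch (mon 0 s (2 * t + 2 * L n)) (q ^ 2) (n k₀) * U n := by
  have h₀ : IsLin fun m : Fin (r + 1) → ℕ => (m 0 : ℤ) := fun x y => by simp
  have hW : IsMono fun m : Fin (r + 1) → ℕ =>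
      tri (m 0) * mon 0 s (2 * t + 2 * L (mergeColour k₀ m)) ^ m 0 := by
    convert (isMono_tri (0 : Fin (r + 1))).mul ((isMono_mon (fun _ => 0) (fun m => s * m 0)
      (fun m => t * m 0) (fun _ _ => 0)).mul (isMono_q_bilin
        (b := fun m m' : Fin (r + 1) → ℕ => (m 0 : ℤ) * L (mergeColour k₀ m'))
        (fun x y z => ?_) fun x y z => ?_)) using 3 with m
    · rw [mon_pow, show q ^ (2 * ((m 0 : ℤ) * L (mergeColour k₀ m))) =
        mon 0 0 (2 * ((m 0 : ℤ) * L (mergeColour k₀ m))) by simp [mon], mon_mul]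
      congr 1 <;> ring
    · rw [Pi.add_apply]; push_cast; ring
    · rw [mergeColour_add, hL]; ring
  convert ((hU.split k₀).mul hW).merge k₀ using 2 with n
  rw [qPoch_eq_sum, sum_mul]
  refine sum_congr rfl fun p hp => ?_
  rw [mergeColour_cons k₀ n hp, Fin.cons_zero]
  ring

/-- A new colour is added which does not occur. -/
theorem IsQ.pad {r : ℕ} {U : (Fin r → ℕ) → F} (hU : IsQ U) :
    IsQ fun n : Fin (r + 1) → ℕ => if n 0 = 0 then U (Fin.tail n) else 0 := by
  convert hU.pushforward Fin.succ using 2 with n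
  have h₀ : ∀ d : Fin r → ℕ, push Fin.succ d = (Fin.cons 0 d : Fin (r + 1) → ℕ) := fun d => by
    ext k
    refine Fin.cases ?_ (fun k => ?_) k
    · exact sum_eq_zero fun i hi => absurd (mem_filter.1 hi).2 (Fin.succ_ne_zero i)
    · simp [push, sum_filter]
  split_ifs with hn
  · have : fib Fin.succ n = {Fin.tail n} := by
      ext d
      rw [mem_fib, mem_singleton, h₀]
      constructor
      · rintro rfl
        simp
      · rintro rfl
        rw [← hn, Fin.cons_self_tail]
    have hq : qn n = qn (Fin.tail n) := by
      simp [qn, Fin.prod_univ_succ, hn, qp_zero, Fin.tail]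
    rw [this, sum_singleton, hq, mul_inv_cancel_left₀ (qn_ne_zero _)]
  · have : fib Fin.succ n = ∅ := by
      refine eq_empty_of_forall_notMem fun d hd => hn ?_
      rw [mem_fib, h₀] at hd
      simp [← hd]
    rw [this, sum_empty, mul_zero]

/-- A coloured quiver form with a single colour is given by a symmetric quiver. -/
theorem IsQ.exists_quiver {U : (Fin 1 → ℕ) → F} (hU : IsQ U) :
    ∃ n : ℕ, 1 ≤ n ∧ ∃ (Q : Matrix (Fin n) (Fin n) ℤ) (qv av : Fin n → ℤ), Q.IsSymm ∧
      ∀ j : ℕ, U (fun _ => j) =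
        ∑ d ∈ (Fintype.piFinset fun _ : Fin n => range (j + 1)).filter (fun d => ∑ i, d i = j),
          (-q) ^ (∑ i, qv i * ((d i : ℕ) : ℤ)) * a ^ (∑ i, av i * ((d i : ℕ) : ℤ)) *
            q ^ (∑ i, ∑ i', ((d i : ℕ) : ℤ) * Q i i' * ((d i' : ℕ) : ℤ)) *
            (qp j / ∏ i, qp (d i)) := by
  obtain ⟨ι, _, _, _, c, W, ⟨l, m, b, hl, hm, hb, hW⟩, h⟩ := hU
  let e := Fintype.equivFin ι
  have hc : ∀ i, c i = 0 := fun i => Subsingleton.elim _ _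
  refine ⟨Fintype.card ι, Fintype.card_pos, fun i i' => b (Pi.single (e.symm i) 1)
    (Pi.single (e.symm i') 1), fun i => l (Pi.single (e.symm i) 1),
    fun i => m (Pi.single (e.symm i) 1), ?_, fun j => ?_⟩
  · ext i i'
    exact hb.1 _ _
  · have hqn : qn (fun _ : Fin 1 => j) = qp j := by simp [qn]
    rw [h, hqn, mul_sum]
    refine sum_bij' (fun d _ => d ∘ e.symm) (fun d _ => d ∘ e) ?_ ?_ ?_ ?_ ?_
    · intro d hd
      have hj : ∑ i, d i = j := by simpa [push, hc] using congrFun (mem_fib.1 hd) 0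
      have hj' : ∑ i, d (e.symm i) = j := by rw [← hj, Equiv.sum_comp e.symm d]
      rw [mem_filter, Fintype.mem_piFinset]
      refine ⟨fun i => ?_, hj'⟩
      rw [mem_range, Nat.lt_succ_iff, ← hj]
      exact single_le_sum (f := d) (fun _ _ => Nat.zero_le _) (mem_univ (e.symm i))
    · intro d hd
      rw [mem_fib]
      ext k
      rw [← (mem_filter.1 hd).2, ← Equiv.sum_comp e d]
      simp [push, hc, Subsingleton.elim k 0]
    · intro d _
      ext i
      simp
    · intro d _
      ext i
      simp
    · intro d _
      have hb' : b d d = ∑ i, ∑ i', (d i : ℤ) * b (Pi.single i 1) (Pi.single i' 1) * (d i' : ℤ) := by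
        rw [IsLin.eq_sum (l := fun x => b x d) fun x y => hb.2 x y d]
        refine sum_congr rfl fun i _ => ?_
        rw [hb.1, IsLin.eq_sum (l := fun x => b x _) fun x y => hb.2 x y _, sum_mul]
        refine sum_congr rfl fun i' _ => ?_
        rw [hb.1]
        ring
      rw [hW, hl.eq_sum d, hm.eq_sum d, hb']
      simp only [Function.comp_apply]
      rw [Equiv.sum_comp e.symm fun i => l (Pi.single i 1) * (d i : ℤ),
        Equiv.sum_comp e.symm fun i => m (Pi.single i 1) * (d i : ℤ),
        Equiv.prod_comp e.symm fun i => qp (d i),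
        ← Equiv.sum_comp e.symm fun i => ∑ i', (d i : ℤ) * b (Pi.single i 1) (Pi.single i' 1) * (d i' : ℤ)]
      simp only [← Equiv.sum_comp e.symm fun i' => (d _ : ℤ) * b (Pi.single _ 1) (Pi.single i' 1) * (d i' : ℤ)]
      rw [qn]
      ring

section MultinomialSums

theorem sum_qm_assoc (j : ℕ) (f : ℕ → ℕ → ℕ → F) :
    ∑ p ∈ antidiagonal j, qm p.1 p.2 * ∑ r ∈ antidiagonal p.1, qm r.1 r.2 * f r.1 r.2 p.2 =
      ∑ p ∈ antidiagonal j, qm p.1 p.2 *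
        ∑ r ∈ antidiagonal p.2, qm r.1 r.2 * f p.1 r.1 r.2 := by
  simp only [mul_sum, sum_sigma']
  refine sum_nbij' (fun t => ⟨(t.2.1, t.2.2 + t.1.2), (t.2.2, t.1.2)⟩)
    (fun t => ⟨(t.1.1 + t.2.1, t.2.2), (t.1.1, t.2.1)⟩) ?_ ?_ ?_ ?_ ?_
  · rintro ⟨⟨h, l⟩, k, i⟩ ht
    simp only [mem_sigma, HasAntidiagonal.mem_antidiagonal, and_true] at ht ⊢
    omega
  · rintro ⟨⟨h, l⟩, k, i⟩ ht
    simp only [mem_sigma, HasAntidiagonal.mem_antidiagonal, and_true] at ht ⊢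
    omega
  · rintro ⟨⟨h, l⟩, k, i⟩ ht
    simp only [mem_sigma, HasAntidiagonal.mem_antidiagonal] at ht
    obtain ⟨_, rfl⟩ := ht
    rfl
  · rintro ⟨⟨h, l⟩, k, i⟩ ht
    simp only [mem_sigma, HasAntidiagonal.mem_antidiagonal] at ht
    obtain ⟨_, rfl⟩ := ht
    rfl
  · rintro ⟨⟨h, l⟩, k, i⟩ ht
    simp only [mem_sigma, HasAntidiagonal.mem_antidiagonal] at ht
    obtain ⟨_, rfl⟩ := ht
    have h₁ := qp_ne_zero (k + i)
    have h₂ := qp_ne_zero (i + l)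
    simp only [qm, add_assoc]
    field_simp

theorem sum_qm_interchange (n : ℕ) (f : ℕ → ℕ → ℕ → ℕ → F) :
    ∑ p ∈ antidiagonal n, qm p.1 p.2 * ∑ r ∈ antidiagonal p.1, qm r.1 r.2 *
        ∑ t ∈ antidiagonal p.2, qm t.1 t.2 * f r.1 r.2 t.1 t.2 =
      ∑ p ∈ antidiagonal n, qm p.1 p.2 * ∑ r ∈ antidiagonal p.1, qm r.1 r.2 *
        ∑ t ∈ antidiagonal p.2, qm t.1 t.2 * f r.1 t.1 r.2 t.2 := by
  simp only [mul_sum, ← sum_product', sum_sigma']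
  refine sum_nbij' (fun t => ⟨(t.2.1.1 + t.2.2.1, t.2.1.2 + t.2.2.2),
      ((t.2.1.1, t.2.2.1), (t.2.1.2, t.2.2.2))⟩)
    (fun t => ⟨(t.2.1.1 + t.2.2.1, t.2.1.2 + t.2.2.2),
      ((t.2.1.1, t.2.2.1), (t.2.1.2, t.2.2.2))⟩) ?_ ?_ ?_ ?_ ?_
  · rintro ⟨⟨k, i⟩, ⟨D, x⟩, E, y⟩ ht
    simp only [mem_sigma, mem_product, HasAntidiagonal.mem_antidiagonal, and_true] at ht ⊢
    omega
  · rintro ⟨⟨k, i⟩, ⟨D, x⟩, E, y⟩ ht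
    simp only [mem_sigma, mem_product, HasAntidiagonal.mem_antidiagonal, and_true] at ht ⊢
    omega
  · rintro ⟨⟨k, i⟩, ⟨D, x⟩, E, y⟩ ht
    simp only [mem_sigma, mem_product, HasAntidiagonal.mem_antidiagonal] at ht
    obtain ⟨_, rfl, rfl⟩ := ht
    rfl
  · rintro ⟨⟨k, i⟩, ⟨D, x⟩, E, y⟩ ht
    simp only [mem_sigma, mem_product, HasAntidiagonal.mem_antidiagonal] at ht
    obtain ⟨_, rfl, rfl⟩ := ht
    rfl
  · rintro ⟨⟨k, i⟩, ⟨D, x⟩, E, y⟩ ht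
    simp only [mem_sigma, mem_product, HasAntidiagonal.mem_antidiagonal] at ht
    obtain ⟨_, rfl, rfl⟩ := ht
    have h₁ := qp_ne_zero (D + x)
    have h₂ := qp_ne_zero (E + y)
    have h₃ := qp_ne_zero (D + E)
    have h₄ := qp_ne_zero (x + y)
    simp only [qm, show D + E + (x + y) = D + x + (E + y) by ring]
    field_simp

end MultinomialSums

section States

/-- The scalar part of a twist coefficient. For `T` the indices are `k, h - k, j - h`, and for `R`
they are `h, k - h, j - k`. -/
def twistWeight (t : Letter) (X : TangleType) (x y z : ℕ) : F :=
  match t, X with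
  | Letter.T, TangleType.UP => mon (-z) 0 ((x : ℤ) ^ 2)
  | Letter.T, TangleType.OP => mon (x + y) x ((x : ℤ) ^ 2 - 2 * (x + y + z) * x)
  | Letter.T, TangleType.RI => mon (x + y) (x + y) ((x : ℤ) ^ 2 - 2 * (x + y + z) * (x + y))
  | Letter.R, TangleType.UP =>
      mon (-(y + z)) (-(y + z)) (-2 * (x + y) * x + (x + y : ℤ) ^ 2 + (x + y + z : ℤ) ^ 2)
  | Letter.R, TangleType.OP => mon (-(y + z)) (-z) (2 * x * z + (z : ℤ) ^ 2)
  | Letter.R, TangleType.RI => mon x 0 (x * (2 * z) + (x + y : ℤ) ^ 2 - (x + y + z : ℤ) ^ 2)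

/-- A twist acting on all colours at once: the coordinate `k` in colour `j` is `V k (j - k)`. -/
def twist (t : Letter) (X : TangleType) (V : ℕ → ℕ → F) (h l : ℕ) : F :=
  match t with
  | Letter.T => ∑ p ∈ antidiagonal h,
      qm p.1 p.2 * (twistWeight t X p.1 p.2 l * V p.1 (p.2 + l))
  | Letter.R => ∑ p ∈ antidiagonal l,
      qm p.1 p.2 * (twistWeight t X h p.1 p.2 * V (h + p.1) p.2)

theorem coef_T (X : TangleType) (x y z : ℕ) :
    coef Letter.T X (x + y + z) x (x + y) = qm x y * twistWeight Letter.T X x y z := by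
  have h : x ≤ x + y ∧ x + y ≤ x + y + z := by omega
  cases X
  · simp only [coef, twistWeight, mon, if_pos h, qbin_add]
    push_cast
    rw [← show (x + y : ℤ) - (x + y + z) = -z by ring]
    simp
    ring
  all_goals
    simp only [coef, twistWeight, mon, if_pos h, qbin_add]
    push_cast
    ring

theorem coef_R (X : TangleType) (x y z : ℕ) :
    coef Letter.R X (x + y + z) (x + y) x = qm y z * twistWeight Letter.R X x y z := by
  have h : x ≤ x + y := by omega
  have h₁ : x + y + z - x = y + z := by omega
  have h₂ : x + y - x = y := by omega
  cases X <;>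
  · simp only [coef, twistWeight, mon, if_pos h, h₁, h₂, qbin_add]
    push_cast
    simp only [show (x : ℤ) - (x + y + z) = -(y + z) by ring,
      show (x + y : ℤ) - (x + y + z) = -z by ring, show (x + y + z : ℤ) - (x + y) = z by ring,
      show 2 * (x + y + z : ℤ) - 2 * (x + y) = 2 * z by ring, neg_sq, zpow_zero, mul_one]
    ring

theorem coef_T_of_lt (X : TangleType) {j h k : ℕ} (hk : h < k) : coef Letter.T X j k h = 0 := by
  cases X <;> simp [coef, hk.not_ge]

theorem coef_R_of_lt (X : TangleType) {j h k : ℕ} (hk : k < h) : coef Letter.R X j k h = 0 := by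
  cases X <;> simp [coef, hk.not_ge]

theorem stepVec_eq_twist (t : Letter) (X : TangleType) (V : ℕ → ℕ → F) (j : ℕ) :
    stepVec t X j (fun k => V k (j - k)) = fun h : Fin (j + 1) => twist t X V h (j - h) := by
  ext ⟨h, hj⟩
  obtain ⟨l, rfl⟩ := Nat.exists_eq_add_of_le (Nat.lt_succ_iff.1 hj)
  rw [stepVec, Fin.sum_univ_eq_sum_range fun k => V k (h + l - k) * coef t X (h + l) k h]
  simp only [Nat.add_sub_cancel_left]
  cases t
  · rw [show h + l + 1 = h + 1 + l by ring, sum_range_add, add_eq_left.2, twist,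
      Finset.Nat.sum_antidiagonal_eq_sum_range_succ
        fun x y => qm x y * (twistWeight Letter.T X x y l * V x (y + l))]
    · refine sum_congr rfl fun k hk => ?_
      obtain ⟨i, rfl⟩ := Nat.exists_eq_add_of_le (Nat.lt_succ_iff.1 (mem_range.1 hk))
      rw [coef_T, Nat.add_sub_cancel_left, add_assoc, Nat.add_sub_cancel_left]
      ring
    · exact sum_eq_zero fun i _ => by rw [coef_T_of_lt X (by omega), mul_zero]
  · rw [add_assoc, sum_range_add, add_eq_right.2, twist,
      Finset.Nat.sum_antidiagonal_eq_sum_range_succ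
        fun x y => qm x y * (twistWeight Letter.R X h x y * V (h + x) y)]
    · refine sum_congr rfl fun k hk => ?_
      obtain ⟨i, rfl⟩ := Nat.exists_eq_add_of_le (Nat.lt_succ_iff.1 (mem_range.1 hk))
      rw [← add_assoc, coef_R, Nat.add_sub_cancel_left, Nat.add_sub_cancel_left]
      ring
    · exact sum_eq_zero fun i hi => by rw [coef_R_of_lt X (mem_range.1 hi), mul_zero]

end States

section Forms

/-- Form of the states whose fraction has parity `0/1`. -/
def FormA (V : ℕ → ℕ → F) : Prop :=
  ∃ u : ℕ → ℕ → F, IsQ (fun n : Fin 2 → ℕ => u (n 0) (n 1)) ∧ ∀ k l, V k l = qp k * u k l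

/-- Form of the states whose fraction has parity `1/0`. -/
def FormB (V : ℕ → ℕ → F) : Prop :=
  ∃ u : ℕ → ℕ → F, IsQ (fun n : Fin 2 → ℕ => u (n 0) (n 1)) ∧ ∀ k l, V k l = qp l * u k l

/-- Form of the states whose fraction has parity `1/1`. -/
def FormC (V : ℕ → ℕ → F) : Prop :=
  ∃ u : ℕ → ℕ → ℕ → F, IsQ (fun n : Fin 3 → ℕ => u (n 0) (n 1) (n 2)) ∧
    ∀ k l, V k l = ∑ p ∈ antidiagonal k, qm p.1 p.2 * ∑ r ∈ antidiagonal l, qm r.1 r.2 *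
      (mon k 0 (2 * k * r.1) * qp (p.1 + r.1) * u p.1 r.1 (p.2 + r.2))

theorem FormA.mul {V : ℕ → ℕ → F} (hV : FormA V) {w : ℕ → ℕ → F}
    (hw : IsMono fun n : Fin 2 → ℕ => w (n 0) (n 1)) : FormA fun k l => w k l * V k l := by
  obtain ⟨u, hu, h⟩ := hV
  exact ⟨fun k l => w k l * u k l, hu.mul hw, fun k l => by beta_reduce; rw [h]; ring⟩

theorem FormB.mul {V : ℕ → ℕ → F} (hV : FormB V) {w : ℕ → ℕ → F}
    (hw : IsMono fun n : Fin 2 → ℕ => w (n 0) (n 1)) : FormB fun k l => w k l * V k l := by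
  obtain ⟨u, hu, h⟩ := hV
  exact ⟨fun k l => w k l * u k l, hu.mul hw, fun k l => by beta_reduce; rw [h]; ring⟩

theorem formC_of_T {u : ℕ → ℕ → F} (hu : IsQ fun n : Fin 2 → ℕ => u (n 0) (n 1)) :
    FormC fun h l => mon h 0 0 *
      ∑ p ∈ antidiagonal h, qm p.1 p.2 * (qp p.1 * u p.1 (p.2 + l)) := by
  refine ⟨fun D E δ => if E = 0 then u D δ else 0,
    hu.pad.reindex ⟨![1, 0, 2], ![1, 0, 2], by decide, by decide⟩, fun h l => ?_⟩
  beta_reduce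
  rw [mul_sum]
  refine sum_congr rfl fun p _ => ?_
  rw [sum_eq_single_of_mem (0, l) (by simp)]
  · simp [qm_zero_left]
    ring
  · rintro ⟨x, y⟩ hp hne
    rw [HasAntidiagonal.mem_antidiagonal] at hp
    have : x ≠ 0 := by
      rintro rfl
      exact hne (by simpa using hp)
    simp [this]

theorem formC_of_R {u : ℕ → ℕ → F} (hu : IsQ fun n : Fin 2 → ℕ => u (n 0) (n 1)) :
    FormC fun h l => ∑ p ∈ antidiagonal l,
      qm p.1 p.2 * (mon h 0 (2 * h * p.2) * (qp p.2 * u (h + p.1) p.2)) := by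
  refine ⟨fun D E δ => if D = 0 then u δ E else 0,
    (hu.reindex ⟨![1, 0], ![1, 0], by decide, by decide⟩).pad, fun h l => ?_⟩
  beta_reduce
  rw [sum_qm_swap l fun x y => mon h 0 (2 * h * y) * (qp y * u (h + x) y)]
  symm
  rw [sum_eq_single_of_mem (0, h) (by simp)]
  · simp [qm_zero_left, mul_assoc]
  · rintro ⟨x, y⟩ hp hne
    rw [HasAntidiagonal.mem_antidiagonal] at hp
    have : x ≠ 0 := by
      rintro rfl
      exact hne (by simpa using hp)
    simp [this]

theorem q_pow_eq_mon' (n : ℕ) : q ^ (2 + 2 * n) = mon 0 0 (2 * 1 + 2 * n) := by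
  rw [q_pow_eq_mon]
  push_cast
  rfl

theorem FormA.of_R {V : ℕ → ℕ → F} (hV : FormA V) {w : ℕ → ℕ → ℕ → F}
    (hw : IsMono fun n : Fin 3 → ℕ => w (n 0) (n 1) (n 2)) :
    FormA fun h l => ∑ p ∈ antidiagonal l,
      qm p.1 p.2 * (w h p.1 p.2 * V (h + p.1) p.2) := by
  obtain ⟨u, hu, h⟩ := hV
  refine ⟨fun h l => ∑ p ∈ antidiagonal l, qm p.1 p.2 *
    (w h p.1 p.2 * (qPoch (mon 0 0 (2 * 1 + 2 * h)) (q ^ 2) p.1 * u (h + p.1) p.2)), ?_,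
    fun h' l => ?_⟩
  · have h₁ : IsQ fun n : Fin 3 → ℕ => w (n 1) (n 0) (n 2) *
        (qPoch (mon 0 0 (2 * 1 + 2 * (n 1))) (q ^ 2) (n 0) * u (n 1 + n 0) (n 2)) :=
      ((hu.split 0).mul_qPoch 0 0 1 fun n => (n 1 : ℤ)).mul
        (hw.comp (f := fun n : Fin 3 → ℕ => ![n 1, n 0, n 2]) fun x y => by
          ext i; fin_cases i <;> rfl)
    exact h₁.merge 1
  · rw [mul_sum]
    refine sum_congr rfl fun p _ => ?_
    rw [h, qp_add, q_pow_eq_mon']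
    ring

theorem FormB.of_T {V : ℕ → ℕ → F} (hV : FormB V) {w : ℕ → ℕ → ℕ → F}
    (hw : IsMono fun n : Fin 3 → ℕ => w (n 0) (n 1) (n 2)) :
    FormB fun h l => ∑ p ∈ antidiagonal h,
      qm p.1 p.2 * (w p.1 p.2 l * V p.1 (p.2 + l)) := by
  obtain ⟨u, hu, h⟩ := hV
  refine ⟨fun h l => ∑ p ∈ antidiagonal h, qm p.1 p.2 *
    (w p.1 p.2 l * (qPoch (mon 0 0 (2 * 1 + 2 * l)) (q ^ 2) p.2 * u p.1 (l + p.2))), ?_,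
    fun h' l => ?_⟩
  · have h₁ : IsQ fun n : Fin 3 → ℕ => w (n 1) (n 0) (n 2) *
        (qPoch (mon 0 0 (2 * 1 + 2 * (n 2))) (q ^ 2) (n 0) * u (n 1) (n 2 + n 0)) :=
      ((hu.split 1).mul_qPoch 0 0 1 fun n => (n 2 : ℤ)).mul
        (hw.comp (f := fun n : Fin 3 → ℕ => ![n 1, n 0, n 2]) fun x y => by
          ext i; fin_cases i <;> rfl)
    exact (h₁.reindex ⟨![1, 0, 2], ![1, 0, 2], by decide, by decide⟩).merge 0
  · rw [mul_sum]
    refine sum_congr rfl fun p _ => ?_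
    rw [h, add_comm p.2 l, qp_add, q_pow_eq_mon']
    ring

theorem mon_tri (x N : ℕ) (c d e : ℤ) (hc : c = e + x) (hd : d = x ^ 2 + 2 * x * N) (y : ℤ) (z : ℤ) :
    mon c y (z + d) = mon e y z * (tri x * (q ^ (2 + 2 * N)) ^ x) := by
  have h : mon (x + x) 0 0 = mon 0 0 (2 * x) := by
    simp [mon, ← two_mul, zpow_mul]
  have h' : mon c y (z + d) =
      mon (e - x) y (z + (x ^ 2 + 2 * x * N)) * mon (x + x) 0 0 := by
    rw [mon_mul, hc, hd]
    congr 1 <;> ring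
  rw [h', h, tri_eq_mon, q_pow_eq_mon, mon_pow, mon_mul, mon_mul, mon_mul]
  congr 1 <;> push_cast <;> ring

/-- The inner summation of the twists of a state in `FormC`. -/
theorem sum_qm_mon (N δ : ℕ) (e z : ℤ) {c d : ℕ → ℤ} (hc : ∀ x, c x = e + x)
    (hd : ∀ x : ℕ, d x = z + (x ^ 2 + 2 * x * N)) :
    ∑ t ∈ antidiagonal δ, qm t.1 t.2 * (mon (c t.1) 0 (d t.1) * qp N) =
      mon e 0 z * qp (N + δ) := by
  rw [qp_add, qPoch_eq_sum, mul_sum, mul_sum]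
  refine sum_congr rfl fun t _ => ?_
  rw [hd, mon_tri t.1 N _ _ e (hc _) rfl]
  ring

theorem FormC.of_T {V : ℕ → ℕ → F} (hV : FormC V) :
    FormA fun h l => ∑ p ∈ antidiagonal h,
      qm p.1 p.2 * (mon 0 0 ((p.1 : ℤ) ^ 2) * V p.1 (p.2 + l)) := by
  obtain ⟨u, hu, hV⟩ := hV
  refine ⟨fun h l => ∑ p ∈ antidiagonal h, qm p.1 p.2 * ∑ r ∈ antidiagonal p.1, qm r.1 r.2 *
    ∑ s ∈ antidiagonal l, qm s.1 s.2 *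
      (mon r.1 0 ((r.1 : ℤ) ^ 2 + 2 * r.1 * (r.2 + s.1) + 2 * r.2 * s.2) *
        (qPoch (mon 0 0 (2 * 1 + 2 * (r.1 + r.2 + p.2))) (q ^ 2) s.1 *
          u r.1 (s.1 + r.2) (s.2 + p.2))), ?_, fun h l => ?_⟩
  · have h₅ : IsQ fun n : Fin 5 → ℕ =>
        mon (n 2) 0 ((n 2 : ℤ) ^ 2 + 2 * n 2 * (n 1 + n 3) + 2 * n 1 * n 4) *
          (qPoch (mon 0 0 (2 * 1 + 2 * (n 2 + n 1 + n 0))) (q ^ 2) (n 3) *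
            u (n 2) (n 3 + n 1) (n 4 + n 0)) := by
      refine (((hu.split 1).split 3).mul_qPoch 3 0 1 fun n => (n 2 + n 1 + n 0 : ℤ)).mul ?_
      convert isMono_mon (fun n : Fin 5 → ℕ => (n 2 : ℤ)) (fun _ => 0) (fun _ => 0)
        (fun x y => x 2 * y 2 + (x 2 * (y 1 + y 3) + y 2 * (x 1 + x 3)) +
          (x 1 * y 4 + y 1 * x 4)) using 3
      ring
    have h₄ := (h₅.reindex ⟨![3, 2, 1, 0, 4], ![3, 2, 1, 0, 4], by decide, by decide⟩).merge 3
    exact (h₄.merge 0).merge 0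
  · have key : ∀ p ∈ antidiagonal h, qm p.1 p.2 * (mon 0 0 ((p.1 : ℤ) ^ 2) * V p.1 (p.2 + l)) =
        qm p.1 p.2 * ∑ r ∈ antidiagonal p.1, qm r.1 r.2 * ∑ t ∈ antidiagonal p.2, qm t.1 t.2 *
          ∑ s ∈ antidiagonal l, qm s.1 s.2 *
            (mon (r.1 + r.2) 0 ((r.1 + r.2) ^ 2 + 2 * (r.1 + r.2) * (t.1 + s.1) + 2 * t.1 * s.2) *
              qp (r.1 + t.1 + s.1) * u r.1 (s.1 + t.1) (s.2 + (r.2 + t.2))) := by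
      intro p _
      rw [hV, mul_sum (antidiagonal p.1) _ (mon _ _ _)]
      congr 1
      refine sum_congr rfl fun r hr => ?_
      rw [HasAntidiagonal.mem_antidiagonal] at hr
      rw [sum_qm_add p.2 l fun x y => mon p.1 0 (2 * p.1 * x) * qp (r.1 + x) * u r.1 x (r.2 + y),
        mul_left_comm, mul_sum (antidiagonal p.2) _ (mon _ _ _)]
      congr 1
      refine sum_congr rfl fun t _ => ?_
      rw [mul_left_comm, mul_sum (antidiagonal l) _ (mon _ _ _)]
      congr 1
      refine sum_congr rfl fun s _ => ?_
      rw [← hr, q_pow_eq_mon, show r.2 + (t.2 + s.2) = s.2 + (r.2 + t.2) by ring,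
        add_comm t.1 s.1, show r.1 + (s.1 + t.1) = r.1 + t.1 + s.1 by ring, mul_left_comm]
      simp only [← mul_assoc]
      congr 2
      rw [mul_assoc, mul_assoc, ← mul_assoc, mon_mul, mul_assoc, mon_mul]
      congr 2 <;> push_cast <;> ring
    beta_reduce
    rw [sum_congr rfl key, sum_qm_interchange h fun D x E y => ∑ s ∈ antidiagonal l, qm s.1 s.2 *
      (mon (D + x) 0 ((D + x) ^ 2 + 2 * (D + x) * (E + s.1) + 2 * E * s.2) *
        qp (D + E + s.1) * u D (s.1 + E) (s.2 + (x + y))), mul_sum]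
    refine sum_congr rfl fun p hp => ?_
    rw [HasAntidiagonal.mem_antidiagonal] at hp
    rw [mul_left_comm, mul_sum _ _ (qp h)]
    congr 1
    refine sum_congr rfl fun r hr => ?_
    rw [HasAntidiagonal.mem_antidiagonal] at hr
    rw [mul_left_comm, mul_sum _ _ (qp h)]
    congr 1
    simp only [mul_sum (antidiagonal l)]
    rw [sum_comm]
    refine sum_congr rfl fun s _ => ?_
    have h₁ := sum_qm_mon (r.1 + r.2 + s.1) p.2 r.1
      ((r.1 : ℤ) ^ 2 + 2 * r.1 * (r.2 + s.1) + 2 * r.2 * s.2) (c := fun x => r.1 + x)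
      (d := fun x => (r.1 + x) ^ 2 + 2 * (r.1 + x) * (r.2 + s.1) + 2 * r.2 * s.2)
      (fun x => rfl) fun x => by push_cast; ring
    have h₂ : qp (r.1 + r.2 + s.1 + p.2) =
        qp h * qPoch (mon 0 0 (2 * 1 + 2 * (r.1 + r.2 + p.2))) (q ^ 2) s.1 := by
      rw [show r.1 + r.2 + s.1 + p.2 = h + s.1 by omega, qp_add, q_pow_eq_mon', ← hp, ← hr]
      push_cast
      rfl
    rw [h₂] at h₁
    calc _ = ∑ t ∈ antidiagonal p.2, qm s.1 s.2 * u r.1 (s.1 + r.2) (s.2 + p.2) *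
          (qm t.1 t.2 * (mon (r.1 + t.1) 0
            ((r.1 + t.1) ^ 2 + 2 * (r.1 + t.1) * (r.2 + s.1) + 2 * r.2 * s.2) *
              qp (r.1 + r.2 + s.1))) := by
          refine sum_congr rfl fun t ht => ?_
          rw [HasAntidiagonal.mem_antidiagonal] at ht
          rw [ht]
          ring
      _ = _ := by
          rw [← mul_sum, h₁]
          ring

theorem FormC.of_R {V : ℕ → ℕ → F} (hV : FormC V) :
    FormB fun h l => ∑ p ∈ antidiagonal l,
      qm p.1 p.2 * (mon 0 0 ((p.1 : ℤ) ^ 2) * V (h + p.1) p.2) := by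
  obtain ⟨u, hu, hV⟩ := hV
  refine ⟨fun h l => ∑ s ∈ antidiagonal h, qm s.1 s.2 * ∑ p ∈ antidiagonal l, qm p.1 p.2 *
    ∑ r ∈ antidiagonal p.1, qm r.1 r.2 *
      (mon (s.1 + s.2 + r.1) 0 ((r.1 : ℤ) ^ 2 + 2 * (s.1 + s.2 + r.1) * r.2) *
        (qPoch (mon 0 0 (2 * 1 + 2 * (r.1 + r.2 + p.2))) (q ^ 2) s.1 *
          u (r.1 + s.1) r.2 (p.2 + s.2))), ?_, fun h l => ?_⟩
  · have h₅ : IsQ fun n : Fin 5 → ℕ =>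
        mon (n 1 + n 0 + n 2) 0 ((n 2 : ℤ) ^ 2 + 2 * (n 1 + n 0 + n 2) * n 3) *
          (qPoch (mon 0 0 (2 * 1 + 2 * (n 2 + n 3 + n 4))) (q ^ 2) (n 1) *
            u (n 2 + n 1) (n 3) (n 4 + n 0)) := by
      refine (((hu.split 0).split 3).mul_qPoch 1 0 1 fun n => (n 2 + n 3 + n 4 : ℤ)).mul ?_
      convert isMono_mon (fun n : Fin 5 → ℕ => (n 1 + n 0 + n 2 : ℤ)) (fun _ => 0) (fun _ => 0)
        (fun x y => x 2 * y 2 + ((x 1 + x 0 + x 2) * y 3 + (y 1 + y 0 + y 2) * x 3)) using 3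
      ring
    have h₄ := (h₅.reindex ⟨![3, 2, 0, 1, 4], ![2, 3, 1, 0, 4], by decide, by decide⟩).merge 0
    exact (h₄.merge 2).merge 0
  · have key : ∀ p ∈ antidiagonal l, qm p.1 p.2 * (mon 0 0 ((p.1 : ℤ) ^ 2) * V (h + p.1) p.2) =
        ∑ s ∈ antidiagonal h, qm s.1 s.2 *
          (qm p.1 p.2 * ∑ t ∈ antidiagonal p.1, qm t.1 t.2 * ∑ r ∈ antidiagonal p.2, qm r.1 r.2 *
            (mon (h + t.1 + t.2) 0
              ((t.1 + t.2) ^ 2 + 2 * (h + t.1 + t.2) * r.1 + 2 * s.1 * t.2) *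
              qp (s.1 + t.1 + r.1) * u (t.1 + s.1) r.1 (t.2 + r.2 + s.2))) := by
      intro p _
      rw [hV, sum_qm_add h p.1 fun x y => ∑ r ∈ antidiagonal p.2, qm r.1 r.2 *
        (mon (h + p.1 : ℕ) 0 (2 * (h + p.1 : ℕ) * r.1) * qp (x + r.1) * u x r.1 (y + r.2)),
        mul_sum (antidiagonal h) _ (mon _ _ _), mul_sum]
      refine sum_congr rfl fun s _ => ?_
      rw [mul_left_comm (mon _ _ _), mul_left_comm, mul_sum (antidiagonal p.1) _ (mon _ _ _)]
      congr 2
      refine sum_congr rfl fun t ht => ?_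
      rw [HasAntidiagonal.mem_antidiagonal] at ht
      rw [mul_left_comm, mul_sum (antidiagonal p.2) _ (q ^ _),
        mul_sum (antidiagonal p.2) _ (mon _ _ _)]
      congr 1
      refine sum_congr rfl fun r _ => ?_
      rw [← ht, q_pow_eq_mon, show s.2 + t.2 + r.2 = t.2 + r.2 + s.2 by ring, add_comm t.1 s.1,
        mul_left_comm (mon _ _ _) (qm r.1 r.2), mul_left_comm (mon _ _ _) (qm r.1 r.2)]
      simp only [← mul_assoc]
      congr 2
      rw [mul_assoc, mul_assoc, ← mul_assoc, mon_mul, mul_assoc, mon_mul]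
      congr 2 <;> push_cast <;> ring
    beta_reduce
    rw [sum_congr rfl key, sum_comm, mul_sum]
    refine sum_congr rfl fun s hs => ?_
    rw [HasAntidiagonal.mem_antidiagonal] at hs
    rw [← mul_sum, mul_left_comm, sum_qm_interchange l fun D x E y =>
      mon (h + D + x) 0 ((D + x) ^ 2 + 2 * (h + D + x) * E + 2 * s.1 * x) *
        qp (s.1 + D + E) * u (D + s.1) E (x + y + s.2), mul_sum _ _ (qp l)]
    congr 1
    refine sum_congr rfl fun p hp => ?_
    rw [HasAntidiagonal.mem_antidiagonal] at hp
    rw [mul_left_comm, mul_sum _ _ (qp l)]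
    congr 1
    refine sum_congr rfl fun r hr => ?_
    rw [HasAntidiagonal.mem_antidiagonal] at hr
    rw [mul_left_comm]
    congr 1
    have h₁ := sum_qm_mon (s.1 + r.1 + r.2) p.2 (h + r.1)
      ((r.1 : ℤ) ^ 2 + 2 * (h + r.1) * r.2) (c := fun x => h + r.1 + x)
      (d := fun x => (r.1 + x) ^ 2 + 2 * (h + r.1 + x) * r.2 + 2 * s.1 * x)
      (fun x => rfl) fun x => by push_cast; ring
    have h₂ : qp (s.1 + r.1 + r.2 + p.2) =
        qp l * qPoch (mon 0 0 (2 * 1 + 2 * (r.1 + r.2 + p.2))) (q ^ 2) s.1 := by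
      rw [show s.1 + r.1 + r.2 + p.2 = l + s.1 by omega, qp_add, q_pow_eq_mon', ← hp, ← hr]
      push_cast
      rfl
    rw [h₂] at h₁
    calc _ = ∑ t ∈ antidiagonal p.2, u (r.1 + s.1) r.2 (p.2 + s.2) *
          (qm t.1 t.2 * (mon (h + r.1 + t.1) 0
            ((r.1 + t.1) ^ 2 + 2 * (h + r.1 + t.1) * r.2 + 2 * s.1 * t.1) *
              qp (s.1 + r.1 + r.2))) := by
          refine sum_congr rfl fun t ht => ?_
          rw [HasAntidiagonal.mem_antidiagonal] at ht
          rw [ht]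
          ring
      _ = _ := by
          rw [← mul_sum, h₁, ← hs]
          push_cast
          ring

end Forms

section Invariant

/-- `isMono_mon` with the last exponent given up to equality. -/
theorem isMono_mon' {r : ℕ} {l m e : (Fin r → ℕ) → ℤ} (L : (Fin r → ℕ) → ℤ)
    (b : (Fin r → ℕ) → (Fin r → ℕ) → ℤ)
    (he : ∀ x, e x = b x x + 2 * L x := by intro x; ring1)
    (hl : IsLin l := by intro x y; (try simp only [Pi.add_apply, Nat.cast_add]) <;> ring1)
    (hm : IsLin m := by intro x y; (try simp only [Pi.add_apply, Nat.cast_add]) <;> ring1)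
    (hL : IsLin L := by intro x y; (try simp only [Pi.add_apply, Nat.cast_add]) <;> ring1)
    (hb : ∀ x y, b x y = b y x := by intro x y; ring)
    (hb' : ∀ x y z, b (x + y) z = b x z + b y z := by
      intro x y z; (try simp only [Pi.add_apply, Nat.cast_add]) <;> ring1) :
    IsMono fun x => mon (l x) (m x) (e x) := by
  simp only [he]
  exact isMono_mon l m L b hl hm hL hb hb'

open Letter TangleType

theorem FormA.twist_T {X : TangleType} {V : ℕ → ℕ → F} (hV : FormA V) (hX : X ≠ RI) :
    FormC (twist T X V) := by
  obtain ⟨u, hu, hV⟩ := hV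
  cases X
  · convert formC_of_T (u := fun k d => mon (-(k + d)) 0 (k ^ 2) * u k d)
      (hu.mul (isMono_mon' (fun _ => 0) fun x y => x 0 * y 0)) using 3 with h l
    rw [twist, mul_sum]
    refine sum_congr rfl fun p hp => ?_
    rw [HasAntidiagonal.mem_antidiagonal] at hp
    rw [hV, twistWeight, show mon (-l) 0 (p.1 ^ 2) =
      mon h 0 0 * mon (-(p.1 + (p.2 + l : ℕ))) 0 (p.1 ^ 2) by
        rw [mon_mul, ← hp]; congr 1 <;> push_cast <;> ring]
    ring
  · convert formC_of_T (u := fun k d => mon 0 k (k ^ 2 - 2 * (k + d) * k) * u k d)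
      (hu.mul (isMono_mon' (fun _ => 0) fun x y => - x 0 * y 0 - x 1 * y 0 - x 0 * y 1))
      using 3 with h l
    rw [twist, mul_sum]
    refine sum_congr rfl fun p hp => ?_
    rw [HasAntidiagonal.mem_antidiagonal] at hp
    rw [hV, twistWeight, show mon (p.1 + p.2) p.1 (p.1 ^ 2 - 2 * (p.1 + p.2 + l) * p.1) =
      mon h 0 0 * mon 0 p.1 (p.1 ^ 2 - 2 * (p.1 + (p.2 + l : ℕ)) * p.1) by
        rw [mon_mul, ← hp]; congr 1 <;> push_cast <;> ring]
    ring
  · exact absurd rfl hX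

theorem FormA.twist_R {X : TangleType} {V : ℕ → ℕ → F} (hV : FormA V) (hX : X ≠ RI) :
    FormA (twist R X V) := by
  cases X
  · exact hV.of_R (w := twistWeight R UP) (isMono_mon' (fun _ => 0) fun x y =>
      -(x 0 + x 1) * y 0 - (y 0 + y 1) * x 0 + (x 0 + x 1) * (y 0 + y 1) +
        (x 0 + x 1 + x 2) * (y 0 + y 1 + y 2))
  · exact hV.of_R (w := twistWeight R OP) (isMono_mon' (fun _ => 0) fun x y =>
      x 0 * y 2 + x 2 * y 0 + x 2 * y 2)
  · exact absurd rfl hX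

theorem FormB.twist_T {X : TangleType} {V : ℕ → ℕ → F} (hV : FormB V) (hX : X ≠ UP) :
    FormB (twist T X V) := by
  cases X
  · exact absurd rfl hX
  · exact hV.of_T (w := twistWeight T OP) (isMono_mon' (fun _ => 0) fun x y =>
      x 0 * y 0 - (x 0 + x 1 + x 2) * y 0 - (y 0 + y 1 + y 2) * x 0)
  · exact hV.of_T (w := twistWeight T RI) (isMono_mon' (fun _ => 0) fun x y =>
      x 0 * y 0 - (x 0 + x 1 + x 2) * (y 0 + y 1) - (y 0 + y 1 + y 2) * (x 0 + x 1))

theorem FormB.twist_R {X : TangleType} {V : ℕ → ℕ → F} (hV : FormB V) (hX : X ≠ UP) :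
    FormC (twist R X V) := by
  obtain ⟨u, hu, hV⟩ := hV
  cases X
  · exact absurd rfl hX
  · convert formC_of_R (u := fun k z => mon (-(k + z)) (-z) (z ^ 2) * u k z)
      (hu.mul (isMono_mon' (fun _ => 0) fun x y => x 1 * y 1)) using 3 with h l
    rw [twist]
    refine sum_congr rfl fun p _ => ?_
    rw [hV, twistWeight, show mon (-(p.1 + p.2)) (-p.2) (2 * h * p.2 + p.2 ^ 2) =
      mon h 0 (2 * h * p.2) * mon (-((h + p.1 : ℕ) + p.2)) (-p.2) (p.2 ^ 2) by
        rw [mon_mul]; congr 1 <;> push_cast <;> ring]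
    ring
  · convert formC_of_R (u := fun k z => mon 0 0 (k ^ 2 - (k + z) ^ 2) * u k z)
      (hu.mul (isMono_mon' (fun _ => 0) fun x y =>
        x 0 * y 0 - (x 0 + x 1) * (y 0 + y 1))) using 3 with h l
    rw [twist]
    refine sum_congr rfl fun p _ => ?_
    rw [hV, twistWeight, show mon h 0 (h * (2 * p.2) + (h + p.1) ^ 2 - (h + p.1 + p.2) ^ 2) =
      mon h 0 (2 * h * p.2) * mon 0 0 ((h + p.1 : ℕ) ^ 2 - ((h + p.1 : ℕ) + p.2) ^ 2) by
        rw [mon_mul]; congr 1; push_cast; ring]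
    ring

theorem FormC.twist_T {X : TangleType} {V : ℕ → ℕ → F} (hV : FormC V) (hX : X ≠ OP) :
    FormA (twist T X V) := by
  cases X
  · convert hV.of_T.mul (w := fun _ l => mon (-l) 0 0)
      (isMono_mon' (fun _ => 0) fun _ _ => 0) using 3 with h l
    rw [twist, mul_sum]
    refine sum_congr rfl fun p _ => ?_
    rw [mul_left_comm (mon _ _ _), ← mul_assoc (mon _ _ _), mon_mul, twistWeight]
    congr 3 <;> ring
  · exact absurd rfl hX
  · convert hV.of_T.mul (w := fun h l => mon h h (-2 * (h + l) * h))
      (isMono_mon' (fun _ => 0) fun x y => -(x 0 + x 1) * y 0 - (y 0 + y 1) * x 0)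
      using 3 with h l
    rw [twist, mul_sum]
    refine sum_congr rfl fun p hp => ?_
    rw [HasAntidiagonal.mem_antidiagonal] at hp
    rw [mul_left_comm (mon _ _ _), ← mul_assoc (mon _ _ _), mon_mul, twistWeight, ← hp]
    congr 3; push_cast; ring

theorem FormC.twist_R {X : TangleType} {V : ℕ → ℕ → F} (hV : FormC V) (hX : X ≠ OP) :
    FormB (twist R X V) := by
  cases X
  · convert hV.of_R.mul (w := fun h l => mon (-l) (-l) ((h + l) ^ 2 - h ^ 2))
      (isMono_mon' (fun _ => 0) fun x y => (x 0 + x 1) * (y 0 + y 1) - x 0 * y 0)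
      using 3 with h l
    rw [twist, mul_sum]
    refine sum_congr rfl fun p hp => ?_
    rw [HasAntidiagonal.mem_antidiagonal] at hp
    rw [mul_left_comm (mon _ _ _), ← mul_assoc (mon _ _ _), mon_mul, twistWeight, ← hp]
    congr 3 <;> push_cast <;> ring
  · exact absurd rfl hX
  · convert hV.of_R.mul (w := fun h l => mon h 0 (2 * h * l + h ^ 2 - (h + l) ^ 2))
      (isMono_mon' (fun _ => 0) fun x y => x 0 * y 1 + x 1 * y 0 + x 0 * y 0 -
        (x 0 + x 1) * (y 0 + y 1)) using 3 with h l
    rw [twist, mul_sum]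
    refine sum_congr rfl fun p hp => ?_
    rw [HasAntidiagonal.mem_antidiagonal] at hp
    rw [mul_left_comm (mon _ _ _), ← mul_assoc (mon _ _ _), mon_mul, twistWeight, ← hp]
    congr 3; push_cast; ring

/-- The form of a state of type `X` whose rational tangle has fraction `p.1 / p.2`. -/
def Invariant (X : TangleType) (p : ℤ × ℤ) (V : ℕ → ℕ → F) : Prop :=
  (X ≠ RI ∧ Even p.1 ∧ Odd p.2 ∧ FormA V) ∨ (X ≠ UP ∧ Odd p.1 ∧ Even p.2 ∧ FormB V) ∨
    (X ≠ OP ∧ Odd p.1 ∧ Odd p.2 ∧ FormC V)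

theorem Invariant.twist {X : TangleType} {p : ℤ × ℤ} {V : ℕ → ℕ → F} (h : Invariant X p V)
    (t : Letter) : Invariant (typeStep t X) (fracStep t p) (twist t X V) := by
  obtain ⟨hX, h₁, h₂, h⟩ | ⟨hX, h₁, h₂, h⟩ | ⟨hX, h₁, h₂, h⟩ := h <;> cases t
  · exact Or.inr (Or.inr ⟨by cases X <;> simp_all [typeStep], h₁.add_odd h₂, h₂, h.twist_T hX⟩)
  · exact Or.inl ⟨by cases X <;> simp_all [typeStep], h₁, h₁.add_odd h₂, h.twist_R hX⟩
  · exact Or.inr (Or.inl ⟨by cases X <;> simp_all [typeStep], h₁.add_even h₂, h₂, h.twist_T hX⟩)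
  · exact Or.inr (Or.inr ⟨by cases X <;> simp_all [typeStep], h₁, h₁.add_even h₂, h.twist_R hX⟩)
  · exact Or.inl ⟨by cases X <;> simp_all [typeStep], h₁.add_odd h₂, h₂, h.twist_T hX⟩
  · exact Or.inr (Or.inl ⟨by cases X <;> simp_all [typeStep], h₁, h₁.add_odd h₂, h.twist_R hX⟩)

theorem typeWord_concat (w : List Letter) (t : Letter) (X : TangleType) :
    typeWord (w ++ [t]) X = typeStep t (typeWord w X) := by
  induction w generalizing X with
  | nil => rfl
  | cons s w ih => exact ih _

theorem runVec_concat (w : List Letter) (t : Letter) (X : TangleType) (j : ℕ)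
    (v : Fin (j + 1) → F) :
    runVec (w ++ [t]) X j v = stepVec t (typeWord w X) j (runVec w X j v) := by
  induction w generalizing X v with
  | nil => rfl
  | cons s w ih => exact ih _ _

theorem exists_invariant (w : List Letter) :
    ∃ V, Invariant (typeWord w UP) (fracWord w) V ∧
      ∀ j, runVec w UP j (e0 j) = fun k : Fin (j + 1) => V k (j - k) := by
  induction w using List.reverseRecOn with
  | nil =>
    refine ⟨fun k _ => if k = 0 then 1 else 0, Or.inl ⟨by simp [typeWord], by simp [fracWord],
      by simp [fracWord], fun k _ => if k = 0 then 1 else 0, ?_, fun k l => ?_⟩, fun j => rfl⟩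
    · have h : IsMono fun _ : Fin 1 → ℕ => mon 0 0 0 := isMono_mon' (fun _ => 0) fun _ _ => 0
      simpa [mon] using h.isQ.pad
    · by_cases hk : k = 0 <;> simp [hk, qp_zero]
  | append_singleton w t ih =>
    obtain ⟨V, hV, hw⟩ := ih
    refine ⟨twist t (typeWord w UP) V, ?_, fun j => ?_⟩
    · rw [typeWord_concat, fracWord, List.foldl_append]
      exact hV.twist t
    · rw [runVec_concat, hw, stepVec_eq_twist]

end Invariant

section Closures

theorem closeUP_eq_sum (j : ℕ) (V : ℕ → ℕ → F) :
    closeUP j (fun k : Fin (j + 1) => V k (j - k)) = ∑ p ∈ antidiagonal j, qm p.1 p.2 *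
      (V p.1 p.2 * (mon 0 (-j) (j ^ 2 + p.1 ^ 2) *
        (qPoch (mon 0 2 (2 - 2 * j - 2 * p.1)) (q ^ 2) j / qp j))) := by
  rw [closeUP, Fin.sum_univ_eq_sum_range fun k => V k (j - k) *
    (a ^ (-(j : ℤ)) * q ^ ((j : ℤ) ^ 2 + (k : ℤ) ^ 2) * qbin j k *
      (qPoch (a ^ 2 * q ^ (2 - 2 * (j : ℤ) - 2 * (k : ℤ))) (q ^ 2) j / qp j)),
    Finset.Nat.sum_antidiagonal_eq_sum_range_succ fun x y => qm x y *
      (V x y * (mon 0 (-j) (j ^ 2 + x ^ 2) *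
        (qPoch (mon 0 2 (2 - 2 * j - 2 * x)) (q ^ 2) j / qp j)))]
  refine sum_congr rfl fun k hk => ?_
  rw [← qbin_add, Nat.add_sub_cancel' (Nat.lt_succ_iff.1 (mem_range.1 hk)),
    show a ^ 2 = a ^ (2 : ℤ) from rfl]
  simp only [mon, zpow_zero, one_mul]
  ring

theorem closeOP_eq_sum (j : ℕ) (V : ℕ → ℕ → F) :
    closeOP j (fun k : Fin (j + 1) => V k (j - k)) = ∑ p ∈ antidiagonal j, qm p.1 p.2 *
      (V p.1 p.2 * (mon 0 (-p.2) (p.2 ^ 2) *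
        (qPoch (mon 0 2 (2 - 2 * j)) (q ^ 2) p.2 / qp p.2))) := by
  rw [closeOP, Fin.sum_univ_eq_sum_range fun k => V k (j - k) *
    (a ^ ((k : ℤ) - (j : ℤ)) * q ^ (((j : ℤ) - (k : ℤ)) ^ 2) * qbin j k *
      (qPoch (a ^ 2 * q ^ (2 - 2 * (j : ℤ))) (q ^ 2) (j - k) / qp (j - k))),
    Finset.Nat.sum_antidiagonal_eq_sum_range_succ fun x y => qm x y *
      (V x y * (mon 0 (-y) (y ^ 2) * (qPoch (mon 0 2 (2 - 2 * j)) (q ^ 2) y / qp y)))]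
  refine sum_congr rfl fun k hk => ?_
  have hk := Nat.lt_succ_iff.1 (mem_range.1 hk)
  rw [← qbin_add, Nat.add_sub_cancel' hk, show a ^ 2 = a ^ (2 : ℤ) from rfl, Nat.cast_sub hk,
    neg_sub]
  simp only [mon, zpow_zero, one_mul]
  ring

open Letter TangleType

theorem FormA.closeUP {V : ℕ → ℕ → F} (hV : FormA V) :
    ∃ U : (Fin 1 → ℕ) → F, IsQ U ∧
      ∀ j, closeUP j (fun k : Fin (j + 1) => twist T UP V k (j - k)) = U fun _ => j := by
  obtain ⟨u, hu, hV⟩ := hV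
  have h₂ : IsQ fun n : Fin 2 → ℕ => mon (-n 1) (-(n 0 + n 1)) (2 * n 0 ^ 2 + (n 0 + n 1) ^ 2) *
      (qPoch (mon 0 2 (2 * 1 + 2 * (-(2 * n 0) - n 1))) (q ^ 2) (n 0) * u (n 0) (n 1)) :=
    (hu.mul_qPoch 0 2 1 fun n => (-(2 * n 0) - n 1 : ℤ)).mul (isMono_mon' (fun _ => 0)
      fun x y => 2 * x 0 * y 0 + (x 0 + x 1) * (y 0 + y 1))
  refine ⟨fun n => ∑ p ∈ antidiagonal (n 0), qm p.1 p.2 *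
    (mon (-p.2) (-(p.1 + p.2)) (2 * p.1 ^ 2 + (p.1 + p.2) ^ 2) *
      (qPoch (mon 0 2 (2 * 1 + 2 * (-(2 * p.1) - p.2))) (q ^ 2) p.1 * u p.1 p.2)),
    h₂.merge 0, fun j => ?_⟩
  rw [closeUP_eq_sum]
  calc _ = ∑ p ∈ antidiagonal j, qm p.1 p.2 * ∑ r ∈ antidiagonal p.1, qm r.1 r.2 *
        (mon (-p.2) (-j) (r.1 ^ 2 + j ^ 2 + (r.1 + r.2) ^ 2) *
          (qPoch (mon 0 2 (2 - 2 * j - 2 * (r.1 + r.2))) (q ^ 2) j / qp j * qp r.1) *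
            u r.1 (r.2 + p.2)) := by
        refine sum_congr rfl fun p _ => ?_
        rw [twist, sum_mul]
        refine congrArg _ (sum_congr rfl fun r hr => ?_)
        rw [HasAntidiagonal.mem_antidiagonal] at hr
        rw [← hr, hV, twistWeight, show mon (-p.2) (-j) (r.1 ^ 2 + j ^ 2 + (r.1 + r.2) ^ 2) =
          mon (-p.2) 0 (r.1 ^ 2) * mon 0 (-j) (j ^ 2 + (r.1 + r.2 : ℕ) ^ 2) by
            rw [mon_mul]; congr 1 <;> push_cast <;> ring]
        push_cast
        ring
    _ = _ := by
        rw [sum_qm_assoc j fun k i l => mon (-l) (-j) (k ^ 2 + j ^ 2 + (k + i) ^ 2) *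
          (qPoch (mon 0 2 (2 - 2 * j - 2 * (k + i))) (q ^ 2) j / qp j * qp k) * u k (i + l)]
        refine sum_congr rfl fun p hp => congrArg _ ?_
        replace hp : p.1 + p.2 = j := HasAntidiagonal.mem_antidiagonal.1 hp
        have h := sum_qm_qPoch_shift p.2 p.1 (mon 0 2 (2 - 2 * j - 2 * p.1))
        rw [add_comm p.2, hp] at h
        calc _ = mon (-p.2) (-j) (2 * p.1 ^ 2 + j ^ 2) * u p.1 p.2 * (qp j)⁻¹ *
              (qp j * qPoch (mon 0 2 (2 - 2 * j - 2 * p.1)) (q ^ 2) p.1) := by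
              rw [← h, mul_sum, mul_sum]
              refine sum_congr rfl fun r hr => ?_
              rw [HasAntidiagonal.mem_antidiagonal] at hr
              rw [hr, show (p.1 : ℤ) ^ 2 + j ^ 2 + (p.1 + r.1) ^ 2 =
                2 * p.1 ^ 2 + j ^ 2 + (r.1 ^ 2 + 2 * r.1 * p.1) by ring,
                mon_tri r.1 p.1 (-r.2) _ (-p.2) (by rw [← hr]; push_cast; ring) rfl,
                ← pow_mul q, show ((q ^ 2) ^ r.1)⁻¹ = mon 0 0 (-(2 * r.1)) by
                  rw [← pow_mul, q_pow_eq_mon]; simp [mon], mon_mul,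
                show (2 - 2 * j - 2 * p.1 + -(2 * r.1) : ℤ) = 2 - 2 * j - 2 * (p.1 + r.1) by ring]
              simp only [add_zero]
              ring
          _ = _ := by
              rw [mul_assoc, inv_mul_cancel_left₀ (qp_ne_zero j), ← hp,
                show (2 - 2 * (p.1 + p.2 : ℕ) - 2 * p.1 : ℤ) = 2 * 1 + 2 * (-(2 * p.1) - p.2) by
                  push_cast; ring]
              push_cast
              ring

theorem FormB.closeOP {V : ℕ → ℕ → F} (hV : FormB V) :
    ∃ U : (Fin 1 → ℕ) → F, IsQ U ∧
      ∀ j, closeOP j (fun k : Fin (j + 1) => twist T RI V k (j - k)) = U fun _ => j := by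
  obtain ⟨u, hu, hV⟩ := hV
  have h₂ : IsQ fun n : Fin 2 → ℕ =>
      mon (n 0 + n 1) (n 0 + n 1) (n 0 ^ 2 - 2 * (n 0 + n 1) ^ 2) *
        (qPoch (mon 0 (-2) (2 * 0 + 2 * (n 0 + n 1))) (q ^ 2) (n 1) * u (n 0) (n 1)) :=
    (hu.mul_qPoch 1 (-2) 0 fun n => (n 0 + n 1 : ℤ)).mul (isMono_mon' (fun _ => 0)
      fun x y => x 0 * y 0 - 2 * (x 0 + x 1) * (y 0 + y 1))
  refine ⟨fun n => ∑ p ∈ antidiagonal (n 0), qm p.1 p.2 *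
    (mon (p.1 + p.2) (p.1 + p.2) (p.1 ^ 2 - 2 * (p.1 + p.2) ^ 2) *
      (qPoch (mon 0 (-2) (2 * 0 + 2 * (p.1 + p.2))) (q ^ 2) p.2 * u p.1 p.2)),
    h₂.merge 0, fun j => ?_⟩
  rw [closeOP_eq_sum]
  calc _ = ∑ p ∈ antidiagonal j, qm p.1 p.2 * ∑ r ∈ antidiagonal p.1, qm r.1 r.2 *
        (mon (r.1 + r.2) (r.1 + r.2 - p.2) (r.1 ^ 2 - 2 * j * (r.1 + r.2) + p.2 ^ 2) *
          (qPoch (mon 0 2 (2 - 2 * j)) (q ^ 2) p.2 / qp p.2 * qp (r.2 + p.2)) *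
            u r.1 (r.2 + p.2)) := by
        refine sum_congr rfl fun p hp => ?_
        rw [HasAntidiagonal.mem_antidiagonal] at hp
        rw [twist, sum_mul]
        refine congrArg _ (sum_congr rfl fun r hr => ?_)
        rw [HasAntidiagonal.mem_antidiagonal] at hr
        rw [hV, twistWeight,
          show mon (r.1 + r.2) (r.1 + r.2 - p.2) (r.1 ^ 2 - 2 * j * (r.1 + r.2) + p.2 ^ 2) =
            mon (r.1 + r.2) (r.1 + r.2) (r.1 ^ 2 - 2 * (r.1 + r.2 + p.2) * (r.1 + r.2)) *
              mon 0 (-p.2) (p.2 ^ 2) by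
            rw [mon_mul, ← hp, ← hr]; congr 1]
        ring
    _ = _ := by
        rw [sum_qm_assoc j fun k i l =>
          mon (k + i) (k + i - l) (k ^ 2 - 2 * j * (k + i) + l ^ 2) *
            (qPoch (mon 0 2 (2 - 2 * j)) (q ^ 2) l / qp l * qp (i + l)) * u k (i + l)]
        refine sum_congr rfl fun p hp => congrArg _ ?_
        replace hp : p.1 + p.2 = j := HasAntidiagonal.mem_antidiagonal.1 hp
        rw [sum_qm_swap p.2 fun i l =>
          mon (p.1 + i) (p.1 + i - l) (p.1 ^ 2 - 2 * j * (p.1 + i) + l ^ 2) *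
            (qPoch (mon 0 2 (2 - 2 * j)) (q ^ 2) l / qp l * qp (i + l)) * u p.1 (i + l)]
        calc _ = mon j j (p.1 ^ 2 - 2 * j ^ 2) * u p.1 p.2 *
              qPoch (mon 0 (-2) (2 * j)) (q ^ 2) p.2 := by
              rw [← sum_qm_qPoch_mul_qPoch p.2 _ (mon 0 2 (2 - 2 * j)), mul_sum]
              refine sum_congr rfl fun r hr => ?_
              rw [HasAntidiagonal.mem_antidiagonal] at hr
              have h : mon 0 (-2) (2 * j) * mon 0 2 (2 - 2 * j) * q ^ (2 * r.1) =
                  q ^ (2 + 2 * r.1) := by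
                rw [q_pow_eq_mon, q_pow_eq_mon, mon_mul, mon_mul]
                congr 1; push_cast; ring
              rw [h, add_comm r.2, qp_add, ← hr, tri_eq_mon, mon_pow, mon_mul,
                show mon (p.1 + r.2) (p.1 + r.2 - r.1)
                    (p.1 ^ 2 - 2 * j * (p.1 + r.2) + r.1 ^ 2) =
                  mon j j (p.1 ^ 2 - 2 * j ^ 2) *
                    mon (-r.1 + 0 * r.1) (0 + -2 * r.1) (r.1 ^ 2 + 2 * j * r.1) by
                  rw [mon_mul, ← hp, ← hr]; congr 1 <;> push_cast <;> ring]
              field_simp [qp_ne_zero]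
          _ = _ := by
              rw [← hp, show (2 * (p.1 + p.2 : ℕ) : ℤ) = 2 * 0 + 2 * (p.1 + p.2) by
                push_cast; ring]
              push_cast
              ring

end Closures

/-- Strengthened quiver form for rational knots: the reduced colored HOMFLY-PT
polynomials, divided by `(q²;q²)_j`, of the numerator closure of a rational tangle
whose closure is a knot are given by a quiver generating function; equivalently the
generating function is in polynomial quiver form. -/
theorem rational_knots_polynomial_quiver_form (w : List Letter)
    (hlast : w.getLast? = some Letter.T)
    (hodd : Odd (fracWord w).1)
    (hX : typeWord w TangleType.UP = TangleType.UP ∨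
      typeWord w TangleType.UP = TangleType.OP) :
    ∃ n : ℕ, 1 ≤ n ∧
      ∃ (Q : Matrix (Fin n) (Fin n) ℤ) (qv av : Fin n → ℤ),
        Q.IsSymm ∧
        ∀ j : ℕ,
          (if typeWord w TangleType.UP = TangleType.UP
            then closeUP j (runVec w TangleType.UP j (e0 j))
            else closeOP j (runVec w TangleType.UP j (e0 j))) =
            ∑ d ∈ (Fintype.piFinset fun _ : Fin n => Finset.range (j + 1)).filter
                (fun d => ∑ i, d i = j),
              (-q) ^ (∑ i, qv i * ((d i : ℕ) : ℤ)) * a ^ (∑ i, av i * ((d i : ℕ) : ℤ)) *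
                q ^ (∑ i, ∑ i', ((d i : ℕ) : ℤ) * Q i i' * ((d i' : ℕ) : ℤ)) *
                (qp j / ∏ i, qp (d i)) := by
  obtain ⟨w, rfl⟩ : ∃ w', w = w' ++ [Letter.T] := by
    obtain ⟨w', h⟩ := List.getLast?_eq_some_iff.1 hlast
    exact ⟨w', h⟩
  obtain ⟨V, hV, hw⟩ := exists_invariant w
  rw [fracWord, List.foldl_append] at hodd
  change Odd ((fracWord w).1 + (fracWord w).2) at hodd
  simp only [runVec_concat, hw, stepVec_eq_twist]
  rw [typeWord_concat] at hX ⊢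
  obtain ⟨h, -, -, hV⟩ | ⟨h, -, -, hV⟩ | ⟨-, h₁, h₂, -⟩ := hV
  · have hw : typeWord w TangleType.UP = TangleType.UP := by
      generalize typeWord w TangleType.UP = X at h hX
      cases X <;> simp_all [typeStep]
    rw [hw]
    obtain ⟨U, hU, hj⟩ := hV.closeUP
    simp only [typeStep, if_true, hj]
    exact hU.exists_quiver
  · have hw : typeWord w TangleType.UP = TangleType.RI := by
      generalize typeWord w TangleType.UP = X at h hX
      cases X <;> simp_all [typeStep]
    rw [hw]
    obtain ⟨U, hU, hj⟩ := hV.closeOP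
    simp only [typeStep, reduceCtorEq, if_false, hj]
    exact hU.exists_quiver
  · exact absurd (h₁.add_odd h₂) (Int.not_even_iff_odd.2 hodd)
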